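/- arXiv:math/0311442 — 3 statements merged into one kernel-verified Lean document; each statement's English description precedes it below -/
import Mathlib

section
/- Let n ≥ 1, 0 ≤ r ≤ n, and let Λ ∈ M_n(k*) be multiplicatively antisymmetric. Let (D, ι) be a division ring of fractions of S_{n,r}^Λ(k), with y_1,…,y_n, x_1,…,x_r the standard generators of S_{n,r}^Λ(k). Let F be the smallest division subring of D containing k·1 and ι(y_1),…,ι(y_n), and let F' be the smallest division subring of D containing k·1 and ι(y_{r+1}),…,ι(y_n). Then the center of D equals Z(F) ∩ F', the intersection of the center of F with F' (as subsets of D). -/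
universe u

/-- A matrix is multiplicatively antisymmetric if `Λ i i = 1` and `Λ i j * Λ j i = 1`
for all `i, j`. -/
def Matrix.MulAntisymmetric {k : Type u} [Field k] {n : ℕ}
    (Λ : Matrix (Fin n) (Fin n) k) : Prop :=
  (∀ i, Λ i i = 1) ∧ ∀ i j, Λ i j * Λ j i = 1

inductive MixedCrossedRel (k : Type u) [Field k] {n : ℕ} (Λ : Matrix (Fin n) (Fin n) k)
    (r : ℕ) (hr : r ≤ n) :
    FreeAlgebra k (Fin n ⊕ Fin r) → FreeAlgebra k (Fin n ⊕ Fin r) → Prop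
  | yy (i j : Fin n) :
      MixedCrossedRel k Λ r hr
        (FreeAlgebra.ι k (Sum.inl i) * FreeAlgebra.ι k (Sum.inl j))
        (algebraMap k _ (Λ i j) * (FreeAlgebra.ι k (Sum.inl j) * FreeAlgebra.ι k (Sum.inl i)))
  | xy_same (i : Fin r) :
      MixedCrossedRel k Λ r hr
        (FreeAlgebra.ι k (Sum.inr i) * FreeAlgebra.ι k (Sum.inl (Fin.castLE hr i)))
        (FreeAlgebra.ι k (Sum.inl (Fin.castLE hr i)) * FreeAlgebra.ι k (Sum.inr i) + 1)
  | xy_ne (i : Fin r) (j : Fin n) (hij : Fin.castLE hr i ≠ j) :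
      MixedCrossedRel k Λ r hr
        (FreeAlgebra.ι k (Sum.inr i) * FreeAlgebra.ι k (Sum.inl j))
        (algebraMap k _ (Λ (Fin.castLE hr i) j)⁻¹ *
          (FreeAlgebra.ι k (Sum.inl j) * FreeAlgebra.ι k (Sum.inr i)))
  | xx (i j : Fin r) :
      MixedCrossedRel k Λ r hr
        (FreeAlgebra.ι k (Sum.inr i) * FreeAlgebra.ι k (Sum.inr j))
        (algebraMap k _ (Λ (Fin.castLE hr i) (Fin.castLE hr j)) *
          (FreeAlgebra.ι k (Sum.inr j) * FreeAlgebra.ι k (Sum.inr i)))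

/-- The mixed crossed polynomial algebra `S_{n,r}^Λ(k)`. -/
def MixedCrossedAlgebra (k : Type u) [Field k] {n : ℕ} (Λ : Matrix (Fin n) (Fin n) k)
    (r : ℕ) (hr : r ≤ n) :=
  RingQuot (MixedCrossedRel k Λ r hr)

noncomputable instance (k : Type u) [Field k] {n : ℕ} (Λ : Matrix (Fin n) (Fin n) k)
    (r : ℕ) (hr : r ≤ n) : Ring (MixedCrossedAlgebra k Λ r hr) := by
  unfold MixedCrossedAlgebra; infer_instance

noncomputable instance (k : Type u) [Field k] {n : ℕ} (Λ : Matrix (Fin n) (Fin n) k)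
    (r : ℕ) (hr : r ≤ n) : Algebra k (MixedCrossedAlgebra k Λ r hr) := by
  unfold MixedCrossedAlgebra; infer_instance

/-- The generator `y_j` of `S_{n,r}^Λ(k)`. -/
noncomputable def MixedCrossedAlgebra.y (k : Type u) [Field k] {n : ℕ}
    (Λ : Matrix (Fin n) (Fin n) k) (r : ℕ) (hr : r ≤ n) (j : Fin n) :
    MixedCrossedAlgebra k Λ r hr :=
  RingQuot.mkAlgHom k (MixedCrossedRel k Λ r hr) (FreeAlgebra.ι k (Sum.inl j))

/-- The generator `x_i` of `S_{n,r}^Λ(k)`. -/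
noncomputable def MixedCrossedAlgebra.x (k : Type u) [Field k] {n : ℕ}
    (Λ : Matrix (Fin n) (Fin n) k) (r : ℕ) (hr : r ≤ n) (i : Fin r) :
    MixedCrossedAlgebra k Λ r hr :=
  RingQuot.mkAlgHom k (MixedCrossedRel k Λ r hr) (FreeAlgebra.ι k (Sum.inr i))


structure FractionDivisionRing (k : Type u) [Field k] (A : Type u) [Ring A] [Algebra k A] where
  carrier : Type u
  [divisionRing : DivisionRing carrier]
  [algebra : Algebra k carrier]
  emb : A →ₐ[k] carrier
  emb_injective : Function.Injective emb
  frac : ∀ d : carrier, ∃ a b : A, b ≠ 0 ∧ d = emb a * (emb b)⁻¹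

attribute [instance] FractionDivisionRing.divisionRing FractionDivisionRing.algebra

/-- Left multiplication by `z` sends some nonzero element of `X` into `X`; in a division ring, for
`X` a subalgebra, this says that `z` is a fraction of elements of `X`. -/
def MapsNonzeroInto {k D : Type*} [Field k] [DivisionRing D] [Algebra k D] (z : D)
    (X : Submodule k D) : Prop :=
  ∃ b ∈ X, b ≠ 0 ∧ z * b ∈ X

namespace MapsNonzeroInto

variable {k D : Type*} [Field k] [DivisionRing D] [Algebra k D]

theorem of_iSupIndep {ι : Type*} {G X : ι → Submodule k D} (hG : iSupIndep G)
    (hXG : ∀ i, X i ≤ G i) {z : D} (hz : ∀ i, ∀ d ∈ G i, z * d ∈ G i)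
    (h : MapsNonzeroInto z (⨆ i, X i)) : ∃ i, MapsNonzeroInto z (X i) := by
  classical
  obtain ⟨b, hb, hb0, hzb⟩ := h
  obtain ⟨f, hf, rfl⟩ := (Submodule.mem_iSup_iff_exists_finsupp _ _).1 hb
  obtain ⟨g, hg, hgz⟩ := (Submodule.mem_iSup_iff_exists_finsupp _ _).1 hzb
  have key : ∀ i ∈ f.support ∪ g.support, g i = z * f i := by
    refine (iSupIndep_iff_finsetSum_eq_imp_eq G).1 hG _ g (fun i => z * f i)
      (fun i _ => ⟨hXG i (hg i), hz i _ (hXG i (hf i))⟩) ?_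
    rw [Finsupp.sum_of_support_subset g Finset.subset_union_right _ (by simp),
      Finsupp.sum_of_support_subset f Finset.subset_union_left _ (by simp), Finset.mul_sum] at hgz
    exact hgz
  have : ∃ i ∈ f.support, f i ≠ 0 := by
    by_contra! hcon
    exact hb0 (Finset.sum_eq_zero hcon)
  obtain ⟨i, hi, hi0⟩ := this
  exact ⟨i, f i, hf i, hi0, key i (Finset.mem_union_left _ hi) ▸ hg i⟩

theorem coeff_eq_zero {Q : Submodule k D} {T : D →ₗ[k] D} {e : ℕ → D} {s : ℕ → k}
    (he : e 0 = 1) (hs : ∀ m, s m ≠ 0) (hT0 : ∀ q ∈ Q, T (q * e 0) = 0)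
    (hT : ∀ q ∈ Q, ∀ m, T (q * e (m + 1)) = s m • (q * e m)) (d : ℕ) :
    ∀ q : ℕ → D, (∀ m, q m ∈ Q) → ∑ m ∈ Finset.range d, q m * e m = 0 → ∀ m < d, q m = 0 := by
  induction d with
  | zero => intro q _ _ m hm; omega
  | succ d ih =>
    intro q hq h
    have h1 : ∀ m < d, q (m + 1) = 0 := by
      intro m hm
      have := ih (fun m => s m • q (m + 1)) (fun m => Q.smul_mem _ (hq _)) (by
        have h2 := congrArg T h
        rw [Finset.sum_range_succ', map_add, map_sum, hT0 _ (hq 0), map_zero, add_zero] at h2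
        rw [← h2]
        refine Finset.sum_congr rfl fun m _ => ?_
        rw [hT _ (hq _), smul_mul_assoc]) m hm
      exact (smul_eq_zero.1 this).resolve_left (hs m)
    have h0 : q 0 = 0 := by
      rw [Finset.sum_range_succ', Finset.sum_eq_zero, zero_add, he, mul_one] at h
      · exact h
      · intro m hm
        rw [h1 m (Finset.mem_range.1 hm), zero_mul]
    rintro (_ | m) hm
    · exact h0
    · exact h1 m (by omega)

theorem of_sum_range {Q : Submodule k D} {T : D →ₗ[k] D} {e : ℕ → D} {s : ℕ → k}
    (he : e 0 = 1) (hs : ∀ m, s m ≠ 0) (hT0 : ∀ q ∈ Q, T (q * e 0) = 0)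
    (hT : ∀ q ∈ Q, ∀ m, T (q * e (m + 1)) = s m • (q * e m))
    {z : D} (hz : ∀ a, T (z * a) = z * T a) (d : ℕ) :
    ∀ q q' : ℕ → D, (∀ m, q m ∈ Q) → (∀ m, q' m ∈ Q) →
      ∑ m ∈ Finset.range (d + 1), q m * e m ≠ 0 →
      z * ∑ m ∈ Finset.range (d + 1), q m * e m = ∑ m ∈ Finset.range (d + 1), q' m * e m →
      MapsNonzeroInto z Q := by
  have shift : ∀ d, ∀ q : ℕ → D, (∀ m, q m ∈ Q) → T (∑ m ∈ Finset.range (d + 1), q m * e m) =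
      ∑ m ∈ Finset.range d, (s m • q (m + 1)) * e m := by
    intro d q hq
    rw [Finset.sum_range_succ', map_add, map_sum, hT0 _ (hq 0), add_zero]
    refine Finset.sum_congr rfl fun m _ => ?_
    rw [hT _ (hq _), smul_mul_assoc]
  have const : ∀ d, ∀ q : ℕ → D, (∀ m, q m ∈ Q) →
      T (∑ m ∈ Finset.range (d + 1), q m * e m) = 0 →
      ∑ m ∈ Finset.range (d + 1), q m * e m = q 0 := by
    intro d q hq h
    rw [shift d q hq] at h
    have h1 := coeff_eq_zero he hs hT0 hT d _ (fun m => Q.smul_mem _ (hq _)) h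
    rw [Finset.sum_range_succ', Finset.sum_eq_zero, zero_add, he, mul_one]
    intro m hm
    rw [(smul_eq_zero.1 (h1 m (Finset.mem_range.1 hm))).resolve_left (hs m), zero_mul]
  induction d with
  | zero =>
    intro q q' hq hq' h0 h
    simp only [zero_add, Finset.sum_range_one, he, mul_one] at h0 h
    exact ⟨q 0, hq 0, h0, h ▸ hq' 0⟩
  | succ d ih =>
    intro q q' hq hq' h0 h
    by_cases hb : T (∑ m ∈ Finset.range (d + 1 + 1), q m * e m) = 0
    · have hb' := const (d + 1) q' hq' (by rw [← h, hz, hb, mul_zero])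
      rw [hb', const (d + 1) q hq hb] at h
      rw [const (d + 1) q hq hb] at h0
      exact ⟨q 0, hq 0, h0, h ▸ hq' 0⟩
    · refine ih (fun m => s m • q (m + 1)) (fun m => s m • q' (m + 1))
        (fun m => Q.smul_mem _ (hq _)) (fun m => Q.smul_mem _ (hq' _)) ?_ ?_
      · rwa [← shift (d + 1) q hq]
      · rw [← shift (d + 1) q hq, ← shift (d + 1) q' hq', ← hz, h]

theorem of_iSup_map_mulRight {Q : Submodule k D} {T : D →ₗ[k] D} {e : ℕ → D} {s : ℕ → k}
    (he : e 0 = 1) (hs : ∀ m, s m ≠ 0) (hT0 : ∀ q ∈ Q, T (q * e 0) = 0)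
    (hT : ∀ q ∈ Q, ∀ m, T (q * e (m + 1)) = s m • (q * e m))
    {z : D} (hz : ∀ a, T (z * a) = z * T a)
    (h : MapsNonzeroInto z (⨆ m, Q.map (LinearMap.mulRight k (e m)))) :
    MapsNonzeroInto z Q := by
  obtain ⟨b, hb, hb0, hzb⟩ := h
  obtain ⟨f, hf, rfl⟩ := (Submodule.mem_iSup_iff_exists_finsupp _ _).1 hb
  obtain ⟨g, hg, hgz⟩ := (Submodule.mem_iSup_iff_exists_finsupp _ _).1 hzb
  choose q hq hqf using hf
  choose q' hq' hqg using hg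
  obtain ⟨d, hd⟩ := (f.support ∪ g.support).exists_nat_subset_range
  have hd' : f.support ∪ g.support ⊆ Finset.range (d + 1) :=
    hd.trans (Finset.range_subset_range.2 d.le_succ)
  have hf' : (f.sum fun _ x => x) = ∑ m ∈ Finset.range (d + 1), q m * e m := by
    rw [Finsupp.sum_of_support_subset f (Finset.subset_union_left.trans hd') _ (by simp)]
    exact Finset.sum_congr rfl fun m _ => (hqf m).symm
  have hg' : (g.sum fun _ x => x) = ∑ m ∈ Finset.range (d + 1), q' m * e m := by
    rw [Finsupp.sum_of_support_subset g (Finset.subset_union_right.trans hd') _ (by simp)]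
    exact Finset.sum_congr rfl fun m _ => (hqg m).symm
  rw [hf'] at hb0 hgz
  exact of_sum_range he hs hT0 hT hz d q q' hq hq' hb0 (by rw [← hg', hgz])

end MapsNonzeroInto

/-- The falling factorial `w (w - 1) ⋯ (w - m + 1)` in a possibly noncommutative ring. -/
def fallingPower {D : Type*} [Ring D] (w : D) : ℕ → D
  | 0 => 1
  | m + 1 => fallingPower w m * (w - m)

theorem commute_fallingPower {D : Type*} [Ring D] {a w : D} (h : Commute a w) (m : ℕ) :
    Commute a (fallingPower w m) := by
  induction m with
  | zero => exact Commute.one_right a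
  | succ m ih => exact ih.mul_right (h.sub_right (Nat.commute_cast a m))

theorem fallingPower_mul_self {D : Type*} [Ring D] (w : D) (m : ℕ) :
    w * fallingPower w m = fallingPower w (m + 1) + m * fallingPower w m := by
  rw [(commute_fallingPower (Commute.refl w) m).eq, fallingPower, mul_sub,
    (Nat.cast_commute m (fallingPower w m)).eq, sub_add_cancel]

theorem fallingPower_succ_mul {D : Type*} [Ring D] {y w : D} (h : w * y = y * (w + 1)) (m : ℕ) :
    fallingPower w (m + 1) * y =
      y * (fallingPower w (m + 1) + (m + 1 : ℕ) * fallingPower w m) := by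
  induction m with
  | zero => simp [fallingPower, h]
  | succ m ih =>
    have hsub : (w - (m + 1 : ℕ)) * y = y * (w - m) := by
      rw [sub_mul, h, (Nat.cast_commute (m + 1) y).eq, ← mul_sub]
      push_cast
      congr 1
      abel
    rw [fallingPower, mul_assoc, hsub, ← mul_assoc, ih, mul_assoc]
    congr 1
    have h1 : fallingPower w (m + 1) = fallingPower w m * (w - m) := rfl
    rw [add_mul, mul_assoc ((m + 1 : ℕ) : D), ← h1,
      show w - (m : D) = (w - (m + 1 : ℕ)) + 1 by push_cast; abel, mul_add, mul_one,
      Nat.cast_succ (m + 1), add_mul _ 1, one_mul]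
    abel

theorem mul_zpow_of_mul_eq {D : Type*} [DivisionRing D] {y w : D} (hy : y ≠ 0)
    (h : w * y = y * (w + 1)) (α : ℤ) : w * y ^ α = y ^ α * (w + α) := by
  induction α using Int.induction_on with
  | zero => simp
  | succ i ih =>
    rw [zpow_add_one₀ hy, ← mul_assoc, ih, mul_assoc, mul_assoc, add_mul, h,
      (Int.cast_commute (i : ℤ) y).eq, ← mul_add]
    push_cast
    congr 2
    abel
  | pred i ih =>
    have h' : ∀ t : ℤ, (w + t) * y⁻¹ = y⁻¹ * (w + (t - 1 : ℤ)) := by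
      intro t
      rw [eq_inv_mul_iff_mul_eq₀ hy, ← mul_assoc, mul_inv_eq_iff_eq_mul₀ hy, add_mul, h,
        (Int.cast_commute (t - 1) y).eq, ← mul_add]
      push_cast
      congr 1
      abel
    rw [zpow_sub_one₀ hy, ← mul_assoc, ih, mul_assoc, mul_assoc, h']

section Descent

variable {k D : Type*} [Field k] [DivisionRing D] [Algebra k D]

/-- The elements of a subspace `A` which right conjugation by `y` multiplies by the scalar `c`. -/
def skewCommuting (A : Submodule k D) (y : D) (c : k) : Submodule k D :=
  A ⊓ LinearMap.ker (LinearMap.mulRight k y - c • LinearMap.mulLeft k y)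

theorem mem_skewCommuting {A : Submodule k D} {y : D} {c : k} {q : D} :
    q ∈ skewCommuting A y c ↔ q ∈ A ∧ q * y = c • (y * q) := by
  simp [skewCommuting, sub_eq_zero]

/-- The span of the monomials `y ^ α * (q * w (w - 1) ⋯ (w - m + 1))` with `q ∈ A` commuting with
`y` up to a nonzero scalar. -/
def laurentSpan (A : Submodule k D) (y w : D) : Submodule k D :=
  Submodule.span k {d | ∃ (α : ℤ) (c : kˣ) (m : ℕ), ∃ q ∈ skewCommuting A y (c : k),
    d = y ^ α * (q * fallingPower w m)}

theorem commute_of_mem_adjoin {s : Set D} {w a : D} (hws : ∀ a ∈ s, w * a = a * w)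
    (ha : a ∈ Algebra.adjoin k s) : w * a = a * w := by
  have hle : Algebra.adjoin k s ≤ Subalgebra.centralizer k {w} :=
    Algebra.adjoin_le fun a ha => by
      rw [SetLike.mem_coe, Subalgebra.mem_centralizer_iff]
      rintro _ rfl
      exact hws a ha
  exact (Subalgebra.mem_centralizer_iff k).1 (hle ha) w rfl

theorem adjoin_le_laurentSpan (s : Set D) {y w : D} (hy : y ≠ 0) (hwy : w * y = y * (w + 1))
    (hws : ∀ a ∈ s, w * a = a * w) (hys : ∀ a ∈ s, ∃ c : kˣ, a * y = (c : k) • (y * a)) :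
    Subalgebra.toSubmodule (Algebra.adjoin k (s ∪ {y, y⁻¹, w})) ≤
      laurentSpan (Subalgebra.toSubmodule (Algebra.adjoin k s)) y w := by
  set A := Subalgebra.toSubmodule (Algebra.adjoin k s)
  have hwA : ∀ a ∈ A, w * a = a * w := fun a ha => commute_of_mem_adjoin hws ha
  have mono : ∀ (α : ℤ) (c : kˣ) (m : ℕ) (q : D), q ∈ skewCommuting A y (c : k) →
      y ^ α * (q * fallingPower w m) ∈ laurentSpan A y w :=
    fun α c m q hq => Submodule.subset_span ⟨α, c, m, q, hq, rfl⟩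
  have step : ∀ x ∈ s ∪ {y, y⁻¹, w}, ∀ d ∈ laurentSpan A y w, x * d ∈ laurentSpan A y w := by
    intro x hx d hd
    induction hd using Submodule.span_induction with
    | zero => rw [mul_zero]; exact zero_mem _
    | add a b _ _ ha hb => rw [mul_add]; exact add_mem ha hb
    | smul t a _ ha => rw [mul_smul_comm]; exact Submodule.smul_mem _ _ ha
    | mem a ha =>
      obtain ⟨α, c, m, q, hq, rfl⟩ := ha
      obtain ⟨hqA, hqy⟩ := mem_skewCommuting.1 hq
      rcases hx with hx | rfl | rfl | rfl
      · obtain ⟨b, hb⟩ := hys x hx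
        have hbα : x * y ^ α = ((b : k) ^ α) • (y ^ α * x) := by
          have h1 : SemiconjBy x y (algebraMap k D b * y) := by
            rw [SemiconjBy, hb, Algebra.smul_def, mul_assoc]
          have h2 := h1.zpow_right₀ α
          rw [SemiconjBy, Commute.mul_zpow (Algebra.commutes (b : k) y), ← map_zpow₀,
            mul_assoc, ← Algebra.smul_def] at h2
          exact h2
        rw [← mul_assoc, hbα, smul_mul_assoc, mul_assoc, ← mul_assoc x]
        refine Submodule.smul_mem _ _ (mono α (b * c) m (x * q) (mem_skewCommuting.2 ⟨?_, ?_⟩))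
        · exact (Algebra.adjoin k s).mul_mem (Algebra.subset_adjoin hx) hqA
        · rw [mul_assoc, hqy, mul_smul_comm, ← mul_assoc, hb, smul_mul_assoc, smul_smul,
            mul_assoc, Units.val_mul, mul_comm]
      · rw [← mul_assoc, ← zpow_one_add₀ hy]
        exact mono _ c m q hq
      · rw [← mul_assoc, ← zpow_neg_one, ← zpow_add₀ hy]
        exact mono _ c m q hq
      · rw [← mul_assoc, mul_zpow_of_mul_eq hy hwy, mul_assoc, ← mul_assoc (x + (α : D)),
          add_mul x, hwA q hqA, (Int.cast_commute α q).eq, ← mul_add, mul_assoc q, add_mul,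
          fallingPower_mul_self, add_assoc, ← add_mul, mul_add, mul_add]
        refine add_mem (mono _ c _ q hq) ?_
        have : y ^ α * (q * (((m : D) + (α : D)) * fallingPower x m)) =
            ((m : k) + (α : k)) • (y ^ α * (q * fallingPower x m)) := by
          rw [← mul_smul_comm, ← mul_smul_comm, Algebra.smul_def]
          simp
        rw [this]
        exact Submodule.smul_mem _ _ (mono _ c _ q hq)
  have h1 : (1 : D) ∈ laurentSpan A y w := by
    have := mono 0 1 0 1 (mem_skewCommuting.2 ⟨one_mem (Algebra.adjoin k s), by simp⟩)
    simpa [fallingPower] using this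
  rw [Algebra.adjoin_toSubmodule_le]
  intro d hd
  induction hd using Submonoid.closure_induction_left with
  | one => exact h1
  | mul_left x hx d _ ih => exact step x hx d ih

theorem MapsNonzeroInto.of_adjoin_union [CharZero k] {z : D} (hz : ∀ d, z * d = d * z)
    (s : Set D) {y w : D} (hy : y ≠ 0) (hwy : w * y = y * (w + 1))
    (hws : ∀ a ∈ s, w * a = a * w) (hys : ∀ a ∈ s, ∃ c : kˣ, a * y = (c : k) • (y * a))
    (h : MapsNonzeroInto z (Subalgebra.toSubmodule (Algebra.adjoin k (s ∪ {y, y⁻¹, w})))) :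
    MapsNonzeroInto z (Subalgebra.toSubmodule (Algebra.adjoin k s)) := by
  set A := Subalgebra.toSubmodule (Algebra.adjoin k s)
  have hwA : ∀ a ∈ A, w * a = a * w := fun a ha => commute_of_mem_adjoin hws ha
  let Y : kˣ → Submodule k D := fun c =>
    ⨆ m, (skewCommuting A y (c : k)).map (LinearMap.mulRight k (fallingPower w m))
  have memY : ∀ (c : kˣ) (m : ℕ) (q : D), q ∈ skewCommuting A y (c : k) →
      q * fallingPower w m ∈ Y c :=
    fun c m q hq => Submodule.mem_iSup_of_mem m (Submodule.mem_map_of_mem hq)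
  let X : ℤ → Submodule k D := fun α => (⨆ c, Y c).map (LinearMap.mulLeft k (y ^ α))
  let ad : Module.End k D := LinearMap.mulLeft k w - LinearMap.mulRight k w
  let σ : Module.End k D := LinearMap.mulLeft k y⁻¹ * LinearMap.mulRight k y
  have had : ∀ d, ad d = w * d - d * w := fun d => rfl
  have hσ : ∀ d, σ d = y⁻¹ * (d * y) := fun d => rfl
  have hwY : ∀ d ∈ ⨆ c, Y c, w * d = d * w := by
    have hle : ⨆ c, Y c ≤ LinearMap.ker ad := by
      refine iSup_le fun c => iSup_le fun m => ?_
      rintro _ ⟨q, hq, rfl⟩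
      rw [LinearMap.mem_ker, had, sub_eq_zero, LinearMap.mulRight_apply]
      exact ((show Commute w q from hwA q (mem_skewCommuting.1 hq).1).mul_right
        (commute_fallingPower (Commute.refl w) m)).eq
    intro d hd
    have := hle hd
    rwa [LinearMap.mem_ker, had, sub_eq_zero] at this
  obtain ⟨α, b, ⟨b', hb', rfl⟩, hb0, ⟨a', ha', hab⟩⟩ :
      ∃ α, MapsNonzeroInto z (X α) := by
    refine of_iSupIndep (G := fun α : ℤ => ad.eigenspace (α : k))
      (ad.eigenspaces_iSupIndep.comp Int.cast_injective) ?_ ?_ ?_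
    · rintro α _ ⟨d, hd, rfl⟩
      rw [Module.End.mem_eigenspace_iff, had, LinearMap.mulLeft_apply, ← mul_assoc,
        mul_zpow_of_mul_eq hy hwy, mul_assoc, mul_assoc, add_mul, hwY d hd, ← mul_sub,
        add_sub_cancel_left, Algebra.smul_def, map_intCast, ← mul_assoc, ← mul_assoc,
        (Int.cast_commute α (y ^ α)).eq]
    · intro α d hd
      rw [Module.End.mem_eigenspace_iff, had] at hd ⊢
      rw [← mul_assoc, ← hz w, mul_assoc, mul_assoc, ← mul_sub, hd, mul_smul_comm]
    · obtain ⟨b, hb, hb0, hzb⟩ := h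
      have hle : laurentSpan A y w ≤ ⨆ α, X α := by
        refine Submodule.span_le.2 ?_
        rintro _ ⟨α, c, m, q, hq, rfl⟩
        exact Submodule.mem_iSup_of_mem α
          (Submodule.mem_map_of_mem (Submodule.mem_iSup_of_mem c (memY c m q hq)))
      have hle' := (adjoin_le_laurentSpan s hy hwy hws hys).trans hle
      exact ⟨b, hle' hb, hb0, hle' hzb⟩
  have hY : MapsNonzeroInto z (⨆ c, Y c) := by
    refine ⟨b', hb', ?_, ?_⟩
    · rintro rfl
      simp at hb0
    · rw [LinearMap.mulLeft_apply, LinearMap.mulLeft_apply, ← mul_assoc, hz, mul_assoc] at hab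
      rwa [← mul_left_cancel₀ (zpow_ne_zero α hy) hab]
  let T : kˣ → Module.End k D := fun c => σ - (c : k) • 1
  have hTz : ∀ c a, T c (z * a) = z * T c a := by
    intro c a
    change y⁻¹ * (z * a * y) - (c : k) • (z * a) = z * (y⁻¹ * (a * y) - (c : k) • a)
    rw [mul_sub, mul_smul_comm, ← mul_assoc z y⁻¹, hz y⁻¹, mul_assoc z a, mul_assoc]
  have hT0 : ∀ c : kˣ, ∀ q ∈ skewCommuting A y (c : k), T c (q * fallingPower w 0) = 0 := by
    intro c q hq
    change y⁻¹ * (q * 1 * y) - (c : k) • (q * 1) = 0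
    rw [mul_one, (mem_skewCommuting.1 hq).2, mul_smul_comm, inv_mul_cancel_left₀ hy, sub_self]
  have hT : ∀ c : kˣ, ∀ q ∈ skewCommuting A y (c : k), ∀ m, T c (q * fallingPower w (m + 1)) =
      ((c : k) * (m + 1 : ℕ)) • (q * fallingPower w m) := by
    intro c q hq m
    change y⁻¹ * (q * fallingPower w (m + 1) * y) - (c : k) • (q * fallingPower w (m + 1)) = _
    rw [mul_assoc q, fallingPower_succ_mul hwy, ← mul_assoc q, (mem_skewCommuting.1 hq).2,
      smul_mul_assoc, mul_smul_comm, mul_assoc y, inv_mul_cancel_left₀ hy, mul_add, smul_add,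
      add_sub_cancel_left, mul_smul, ← mul_smul_comm ((m + 1 : ℕ) : k), Algebra.smul_def _
      (fallingPower w m), map_natCast]
  obtain ⟨c, hc⟩ : ∃ c, MapsNonzeroInto z (Y c) := by
    refine of_iSupIndep (G := fun c : kˣ => σ.maxGenEigenspace (c : k))
      (σ.independent_maxGenEigenspace.comp Units.val_injective) ?_ ?_ hY
    · refine fun c => iSup_le fun m => ?_
      rintro _ ⟨q, hq, rfl⟩
      rw [Module.End.mem_maxGenEigenspace, LinearMap.mulRight_apply]
      refine ⟨m + 1, ?_⟩
      change (T c ^ (m + 1)) _ = 0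
      induction m with
      | zero => rw [zero_add, pow_one, hT0 c q hq]
      | succ m ih => rw [pow_succ, Module.End.mul_apply, hT c q hq, map_smul, ih, smul_zero]
    · intro c d hd
      rw [Module.End.mem_maxGenEigenspace] at hd ⊢
      obtain ⟨N, hN⟩ := hd
      refine ⟨N, ?_⟩
      change (T c ^ N) d = 0 at hN
      change (T c ^ N) (z * d) = 0
      have hpow : ∀ N d, (T c ^ N) (z * d) = z * (T c ^ N) d := by
        intro N
        induction N with
        | zero => intro d; rfl
        | succ N ih => intro d; rw [pow_succ, Module.End.mul_apply, hTz, ih, Module.End.mul_apply]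
      rw [hpow, hN, mul_zero]
  obtain ⟨b, hb, hb0, hzb⟩ := of_iSup_map_mulRight (Q := skewCommuting A y (c : k)) (T := T c)
    (s := fun m => (c : k) * (m + 1 : ℕ)) rfl
    (fun m => mul_ne_zero c.ne_zero (Nat.cast_ne_zero.2 m.succ_ne_zero)) (hT0 c) (hT c) (hTz c) hc
  exact ⟨b, hb.1, hb0, hzb.1⟩

end Descent

/-- Elements of a `k`-algebra satisfying the defining relations of `S_{n,r}^Λ(k)`. -/
structure IsMixedCrossedSystem {k D : Type*} [Field k] [DivisionRing D] [Algebra k D] {n r : ℕ}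
    (hr : r ≤ n) (Λ : Matrix (Fin n) (Fin n) k) (Y : Fin n → D) (X : Fin r → D) : Prop where
  yy : ∀ i j, Y i * Y j = Λ i j • (Y j * Y i)
  xy_same : ∀ i, X i * Y (Fin.castLE hr i) = Y (Fin.castLE hr i) * X i + 1
  xy_ne : ∀ i j, Fin.castLE hr i ≠ j → X i * Y j = (Λ (Fin.castLE hr i) j)⁻¹ • (Y j * X i)
  xx : ∀ i j, X i * X j = Λ (Fin.castLE hr i) (Fin.castLE hr j) • (X j * X i)

namespace IsMixedCrossedSystem

variable {k D : Type*} [Field k] [DivisionRing D] [Algebra k D] {n r : ℕ} {hr : r ≤ n}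
  {Λ : Matrix (Fin n) (Fin n) k} {Y : Fin n → D} {X : Fin r → D}

/-- The generators `y_j` for `j ≥ r`, together with `y_l`, `y_l⁻¹` and `y_l x_l` for `l < i`. -/
def partialGenerators (hr : r ≤ n) (Y : Fin n → D) (X : Fin r → D) (i : ℕ) : Set D :=
  {d | ∃ j : Fin n, r ≤ (j : ℕ) ∧ d = Y j} ∪
    ⋃ (l : Fin r) (_ : (l : ℕ) < i),
      {Y (Fin.castLE hr l), (Y (Fin.castLE hr l))⁻¹, Y (Fin.castLE hr l) * X l}

theorem partialGenerators_zero :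
    partialGenerators hr Y X 0 = {d | ∃ j : Fin n, r ≤ (j : ℕ) ∧ d = Y j} := by
  simp [partialGenerators]

theorem partialGenerators_succ (i : Fin r) :
    partialGenerators hr Y X (i + 1) = partialGenerators hr Y X i ∪
      {Y (Fin.castLE hr i), (Y (Fin.castLE hr i))⁻¹, Y (Fin.castLE hr i) * X i} := by
  rw [partialGenerators, partialGenerators, Set.union_assoc]
  congr 1
  apply subset_antisymm
  · refine Set.iUnion₂_subset fun l hl => ?_
    rcases Nat.lt_succ_iff_lt_or_eq.1 hl with h | h
    · exact (Set.subset_iUnion₂ (s := fun (l : Fin r) (_ : (l : ℕ) < i) =>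
        ({Y (Fin.castLE hr l), (Y (Fin.castLE hr l))⁻¹, Y (Fin.castLE hr l) * X l} : Set D))
          l h).trans Set.subset_union_left
    · obtain rfl := Fin.ext h
      exact Set.subset_union_right
  · refine Set.union_subset (Set.iUnion₂_subset fun l hl => ?_) ?_
    · exact Set.subset_iUnion₂ (s := fun (l : Fin r) (_ : (l : ℕ) < i + 1) =>
        ({Y (Fin.castLE hr l), (Y (Fin.castLE hr l))⁻¹, Y (Fin.castLE hr l) * X l} : Set D))
          l (hl.trans i.1.lt_succ_self)
    · exact Set.subset_iUnion₂ (s := fun (l : Fin r) (_ : (l : ℕ) < i + 1) =>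
        ({Y (Fin.castLE hr l), (Y (Fin.castLE hr l))⁻¹, Y (Fin.castLE hr l) * X l} : Set D))
          i i.1.lt_succ_self

theorem y_ne_zero (h : IsMixedCrossedSystem hr Λ Y X) (i : Fin r) : Y (Fin.castLE hr i) ≠ 0 := by
  intro h0
  simpa [h0] using h.xy_same i

theorem yx_mul_y_same (h : IsMixedCrossedSystem hr Λ Y X) (i : Fin r) :
    Y (Fin.castLE hr i) * X i * Y (Fin.castLE hr i) =
      Y (Fin.castLE hr i) * (Y (Fin.castLE hr i) * X i + 1) := by
  rw [mul_assoc, h.xy_same]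

theorem commute_yx_y (h : IsMixedCrossedSystem hr Λ Y X) (hΛ : Λ.MulAntisymmetric) {i : Fin r}
    {j : Fin n} (hij : Fin.castLE hr i ≠ j) : Commute (Y (Fin.castLE hr i) * X i) (Y j) := by
  have h0 : Λ (Fin.castLE hr i) j ≠ 0 := left_ne_zero_of_mul_eq_one (hΛ.2 _ _)
  rw [Commute, SemiconjBy, mul_assoc, h.xy_ne i j hij, mul_smul_comm, ← mul_assoc, h.yy,
    smul_mul_assoc, smul_smul, inv_mul_cancel₀ h0, one_smul, mul_assoc]

theorem commute_yx_x (h : IsMixedCrossedSystem hr Λ Y X) (hΛ : Λ.MulAntisymmetric) {i l : Fin r}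
    (hil : i ≠ l) : Commute (Y (Fin.castLE hr i) * X i) (X l) := by
  have hne : Fin.castLE hr l ≠ Fin.castLE hr i := by
    simpa [Fin.ext_iff] using fun h => hil (Fin.ext h.symm)
  rw [Commute, SemiconjBy, ← mul_assoc, h.xy_ne l _ hne, mul_assoc, h.xx, mul_smul_comm,
    smul_mul_assoc, mul_assoc, eq_inv_of_mul_eq_one_left (hΛ.2 (Fin.castLE hr i) (Fin.castLE hr l))]

theorem commute_yx_partialGenerators (h : IsMixedCrossedSystem hr Λ Y X)
    (hΛ : Λ.MulAntisymmetric) (i : Fin r) :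
    ∀ a ∈ partialGenerators hr Y X i, Commute (Y (Fin.castLE hr i) * X i) a := by
  rintro a (⟨j, hj, rfl⟩ | ha)
  · exact h.commute_yx_y hΛ fun he => by
      rw [← he] at hj
      exact absurd i.2 (not_lt.2 hj)
  · simp only [Set.mem_iUnion] at ha
    obtain ⟨l, hl, ha⟩ := ha
    have hil : i ≠ l := fun he => by simp [he] at hl
    have hy := h.commute_yx_y hΛ (i := i) (j := Fin.castLE hr l)
      (by simpa [Fin.ext_iff] using fun h => hil (Fin.ext h))
    rcases ha with rfl | rfl | rfl
    · exact hy
    · exact hy.inv_right₀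
    · exact hy.mul_right (h.commute_yx_x hΛ hil)

theorem partialGenerators_mul_y (h : IsMixedCrossedSystem hr Λ Y X)
    (hΛ : Λ.MulAntisymmetric) (i : Fin r) :
    ∀ a ∈ partialGenerators hr Y X i, ∃ c : kˣ,
      a * Y (Fin.castLE hr i) = (c : k) • (Y (Fin.castLE hr i) * a) := by
  have h0 : ∀ i j, Λ i j ≠ 0 := fun i j => left_ne_zero_of_mul_eq_one (hΛ.2 _ _)
  rintro a (⟨j, hj, rfl⟩ | ha)
  · exact ⟨Units.mk0 _ (h0 _ _), h.yy _ _⟩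
  · simp only [Set.mem_iUnion] at ha
    obtain ⟨l, hl, ha⟩ := ha
    have hil : l ≠ i := fun he => by simp [he] at hl
    rcases ha with rfl | rfl | rfl
    · exact ⟨Units.mk0 _ (h0 _ _), h.yy _ _⟩
    · refine ⟨Units.mk0 _ (h0 (Fin.castLE hr i) (Fin.castLE hr l)), ?_⟩
      rw [Units.val_mk0, inv_mul_eq_iff_eq_mul₀ (h.y_ne_zero l), mul_smul_comm, ← mul_assoc,
        ← smul_mul_assoc, ← h.yy, mul_inv_cancel_right₀ (h.y_ne_zero l)]
    · refine ⟨1, ?_⟩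
      rw [Units.val_one, one_smul]
      exact h.commute_yx_y hΛ (by simpa [Fin.ext_iff] using fun h => hil (Fin.ext h))

theorem mapsNonzeroInto_adjoin_y [CharZero k] (h : IsMixedCrossedSystem hr Λ Y X)
    (hΛ : Λ.MulAntisymmetric) {z : D} (hz : ∀ d, z * d = d * z)
    (hfrac : MapsNonzeroInto z
      (Subalgebra.toSubmodule (Algebra.adjoin k (Set.range Y ∪ Set.range X)))) :
    MapsNonzeroInto z (Subalgebra.toSubmodule
      (Algebra.adjoin k {d | ∃ j : Fin n, r ≤ (j : ℕ) ∧ d = Y j})) := by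
  have hstart : MapsNonzeroInto z
      (Subalgebra.toSubmodule (Algebra.adjoin k (partialGenerators hr Y X r))) := by
    have hmem : ∀ l : Fin r, ∀ a ∈ ({Y (Fin.castLE hr l), (Y (Fin.castLE hr l))⁻¹,
        Y (Fin.castLE hr l) * X l} : Set D),
        a ∈ Algebra.adjoin k (partialGenerators hr Y X r) := fun l a ha =>
      Algebra.subset_adjoin (Or.inr (Set.mem_iUnion₂.2 ⟨l, l.2, ha⟩))
    have hle : Algebra.adjoin k (Set.range Y ∪ Set.range X) ≤
        Algebra.adjoin k (partialGenerators hr Y X r) := by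
      refine Algebra.adjoin_le ?_
      rintro _ (⟨j, rfl⟩ | ⟨i, rfl⟩)
      · by_cases hj : r ≤ (j : ℕ)
        · exact Algebra.subset_adjoin (Or.inl ⟨j, hj, rfl⟩)
        · exact hmem ⟨j, not_le.1 hj⟩ _ (Or.inl rfl)
      · have := mul_mem (hmem i _ (Or.inr (Or.inl rfl))) (hmem i _ (Or.inr (Or.inr rfl)))
        rwa [inv_mul_cancel_left₀ (h.y_ne_zero i)] at this
    obtain ⟨b, hb, hb0, hzb⟩ := hfrac
    exact ⟨b, hle hb, hb0, hle hzb⟩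
  have hdesc : ∀ i ≤ r, MapsNonzeroInto z
      (Subalgebra.toSubmodule (Algebra.adjoin k (partialGenerators hr Y X i))) →
      MapsNonzeroInto z
        (Subalgebra.toSubmodule (Algebra.adjoin k (partialGenerators hr Y X 0))) := by
    intro i
    induction i with
    | zero => exact fun _ => id
    | succ i ih =>
      intro hi hm
      refine ih (by omega) ?_
      let l : Fin r := ⟨i, hi⟩
      have hsucc : partialGenerators hr Y X (i + 1) = partialGenerators hr Y X i ∪
          {Y (Fin.castLE hr l), (Y (Fin.castLE hr l))⁻¹, Y (Fin.castLE hr l) * X l} :=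
        partialGenerators_succ l
      rw [hsucc] at hm
      exact hm.of_adjoin_union hz _ (h.y_ne_zero l) (h.yx_mul_y_same l)
        (fun a ha => h.commute_yx_partialGenerators hΛ l a ha) (h.partialGenerators_mul_y hΛ l)
  rw [← partialGenerators_zero]
  exact hdesc r le_rfl hstart

theorem mem_closure_of_central [CharZero k] (h : IsMixedCrossedSystem hr Λ Y X)
    (hΛ : Λ.MulAntisymmetric) {z : D} (hz : ∀ d, z * d = d * z)
    (hfrac : MapsNonzeroInto z
      (Subalgebra.toSubmodule (Algebra.adjoin k (Set.range Y ∪ Set.range X)))) :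
    z ∈ Subfield.closure (Set.range (algebraMap k D) ∪
      {d : D | ∃ j : Fin n, r ≤ (j : ℕ) ∧ d = Y j}) := by
  obtain ⟨b, hb, hb0, hzb⟩ := h.mapsNonzeroInto_adjoin_y hΛ hz hfrac
  have hle : ∀ d ∈ Algebra.adjoin k {d | ∃ j : Fin n, r ≤ (j : ℕ) ∧ d = Y j},
      d ∈ Subfield.closure (Set.range (algebraMap k D) ∪
        {d : D | ∃ j : Fin n, r ≤ (j : ℕ) ∧ d = Y j}) := by
    intro d hd
    induction hd using Algebra.adjoin_induction with
    | mem x hx => exact Subfield.subset_closure (Or.inr hx)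
    | algebraMap c => exact Subfield.subset_closure (Or.inl ⟨c, rfl⟩)
    | add x y _ _ hx hy => exact add_mem hx hy
    | mul x y _ _ hx hy => exact mul_mem hx hy
  have := mul_mem (hle _ hzb) (inv_mem (hle _ hb))
  rwa [mul_inv_cancel_right₀ hb0] at this

theorem commute_x (h : IsMixedCrossedSystem hr Λ Y X) (hΛ : Λ.MulAntisymmetric) {z : D}
    (hz : z ∈ Subfield.closure (Set.range (algebraMap k D) ∪
      {d : D | ∃ j : Fin n, r ≤ (j : ℕ) ∧ d = Y j}))
    (hy : ∀ j, Commute z (Y j)) (i : Fin r) : Commute z (X i) := by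
  have hw : Commute (Y (Fin.castLE hr i) * X i) z := by
    clear hy
    induction hz using Subfield.closure_induction with
    | mem a ha =>
      obtain ⟨c, rfl⟩ | ⟨j, hj, rfl⟩ := ha
      · exact (Algebra.commutes c _).symm
      · exact h.commute_yx_y hΛ fun he => by
          rw [← he] at hj
          exact absurd i.2 (not_lt.2 hj)
    | one => exact Commute.one_right _
    | add a b _ _ ha hb => exact ha.add_right hb
    | neg a _ ha => exact ha.neg_right
    | inv a _ ha => exact ha.inv_right₀
    | mul a b _ _ ha hb => exact ha.mul_right hb
  have := (hy (Fin.castLE hr i)).inv_right₀.mul_right hw.symm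
  rwa [inv_mul_cancel_left₀ (h.y_ne_zero i)] at this

end IsMixedCrossedSystem

namespace FractionDivisionRing

variable {k : Type u} [Field k] {n r : ℕ} {hr : r ≤ n} {Λ : Matrix (Fin n) (Fin n) k}

theorem isMixedCrossedSystem (F : FractionDivisionRing k (MixedCrossedAlgebra k Λ r hr)) :
    IsMixedCrossedSystem hr Λ (fun i => F.emb (MixedCrossedAlgebra.y k Λ r hr i))
      (fun i => F.emb (MixedCrossedAlgebra.x k Λ r hr i)) := by
  let π : FreeAlgebra k (Fin n ⊕ Fin r) →ₐ[k] MixedCrossedAlgebra k Λ r hr :=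
    RingQuot.mkAlgHom k (MixedCrossedRel k Λ r hr)
  have hπ : ∀ {a b}, MixedCrossedRel k Λ r hr a b → F.emb (π a) = F.emb (π b) :=
    fun hab => congrArg F.emb (RingQuot.mkAlgHom_rel k hab)
  constructor
  · intro i j
    have := hπ (MixedCrossedRel.yy i j)
    rw [← Algebra.smul_def] at this
    simp only [map_mul, map_smul] at this
    exact this
  · intro i
    have := hπ (MixedCrossedRel.xy_same i)
    simp only [map_mul, map_add, map_one] at this
    exact this
  · intro i j hij
    have := hπ (MixedCrossedRel.xy_ne i j hij)
    rw [← Algebra.smul_def] at this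
    simp only [map_mul, map_smul] at this
    exact this
  · intro i j
    have := hπ (MixedCrossedRel.xx i j)
    rw [← Algebra.smul_def] at this
    simp only [map_mul, map_smul] at this
    exact this

theorem emb_mem_adjoin (F : FractionDivisionRing k (MixedCrossedAlgebra k Λ r hr))
    (a : MixedCrossedAlgebra k Λ r hr) :
    F.emb a ∈ Algebra.adjoin k
      (Set.range (fun i => F.emb (MixedCrossedAlgebra.y k Λ r hr i)) ∪
        Set.range fun i => F.emb (MixedCrossedAlgebra.x k Λ r hr i)) := by
  let π : FreeAlgebra k (Fin n ⊕ Fin r) →ₐ[k] MixedCrossedAlgebra k Λ r hr :=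
    RingQuot.mkAlgHom k (MixedCrossedRel k Λ r hr)
  obtain ⟨p, rfl⟩ : ∃ p, π p = a := RingQuot.mkAlgHom_surjective k _ a
  induction p using FreeAlgebra.induction with
  | grade0 c => rw [AlgHom.commutes, AlgHom.commutes]; exact Subalgebra.algebraMap_mem _ c
  | grade1 g =>
    rcases g with j | i
    · exact Algebra.subset_adjoin (Or.inl ⟨j, rfl⟩)
    · exact Algebra.subset_adjoin (Or.inr ⟨i, rfl⟩)
  | mul a b ha hb => rw [map_mul, map_mul]; exact mul_mem ha hb
  | add a b ha hb => rw [map_add, map_add]; exact add_mem ha hb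

end FractionDivisionRing

/-- The center of a division ring of fractions `D` of `S_{n,r}^Λ(k)` equals
`Z(F) ∩ F'`, where `F` is the smallest division subring of `D` containing `k·1` and the
`y_1,…,y_n`, and `F'` the smallest division subring containing `k·1` and `y_{r+1},…,y_n`. -/
theorem stmt3 {k : Type u} [Field k] [CharZero k] {n : ℕ} (hn : 1 ≤ n) {r : ℕ} (hr : r ≤ n)
    (Λ : Matrix (Fin n) (Fin n) k) (hΛ : Λ.MulAntisymmetric)
    (F : FractionDivisionRing k (MixedCrossedAlgebra k Λ r hr)) :
    (Subring.center F.carrier : Set F.carrier) =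
      {d : F.carrier |
          d ∈ Subfield.closure (Set.range (algebraMap k F.carrier) ∪
            Set.range fun i : Fin n => F.emb (MixedCrossedAlgebra.y k Λ r hr i)) ∧
          ∀ e ∈ Subfield.closure (Set.range (algebraMap k F.carrier) ∪
            Set.range fun i : Fin n => F.emb (MixedCrossedAlgebra.y k Λ r hr i)),
            d * e = e * d} ∩
      (Subfield.closure (Set.range (algebraMap k F.carrier) ∪
          {d : F.carrier | ∃ i : Fin n, r ≤ (i : ℕ) ∧
            d = F.emb (MixedCrossedAlgebra.y k Λ r hr i)}) : Set F.carrier) := by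
  have hsys := F.isMixedCrossedSystem
  ext z
  constructor
  · intro hz
    have hz' : ∀ d, z * d = d * z := fun d => (Subring.mem_center_iff.1 hz d).symm
    obtain ⟨a, b, hb0, rfl⟩ := F.frac z
    have hb : F.emb b ≠ 0 := (map_ne_zero_iff F.emb F.emb_injective).2 hb0
    have hF' := hsys.mem_closure_of_central hΛ hz' ⟨F.emb b, F.emb_mem_adjoin b, hb, by
      rw [inv_mul_cancel_right₀ hb]
      exact F.emb_mem_adjoin a⟩
    refine ⟨⟨Subfield.closure_mono (Set.union_subset_union_right _ ?_) hF',
      fun e _ => hz' e⟩, hF'⟩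
    rintro _ ⟨j, _, rfl⟩
    exact ⟨j, rfl⟩
  · rintro ⟨⟨_, hcomm⟩, hF'⟩
    have hy : ∀ j, Commute z (F.emb (MixedCrossedAlgebra.y k Λ r hr j)) := fun j =>
      hcomm _ (Subfield.subset_closure (Or.inr ⟨j, rfl⟩))
    have hx := hsys.commute_x hΛ hF' hy
    have hS : ∀ a, Commute z (F.emb a) := fun a =>
      (commute_of_mem_adjoin (w := z) (by
        rintro _ (⟨j, rfl⟩ | ⟨i, rfl⟩)
        · exact hy j
        · exact hx i) (F.emb_mem_adjoin a))
    refine Subring.mem_center_iff.2 fun d => ?_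
    obtain ⟨a, b, _, rfl⟩ := F.frac d
    exact ((hS a).mul_right (hS b).inv_right₀).eq.symm
end

section
/- Let n ≥ 1, 0 ≤ r ≤ n, and let Λ = (λ_{i,j}) ∈ M_n(k*) be multiplicatively antisymmetric. Let (D, ι) be a division ring of fractions of S_{n,r}^Λ(k). Then: (1) the intersection of the derived subgroup of the multiplicative group D^× (the subgroup generated by all commutators a·b·a^{-1}·b^{-1}) with the set of nonzero scalars k*·1 equals the subgroup of k*·1 generated by the entries λ_{i,j} of Λ; (2) if r ≥ 1 then the intersection of the k-linear span of {a·b − b·a : a, b ∈ D} with the scalars k·1 equals all of k·1, while if r = 0 this intersection equals {0}. -/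
universe u

section OreExtension

variable {S D : Type*} [Ring S] [DivisionRing D]

theorem exists_common_multiple {ι : S →+* D} (hι : Function.Injective ι)
    (frac : ∀ d : D, ∃ a b : S, b ≠ 0 ∧ d = ι a * (ι b)⁻¹) (a b : S) (hb : b ≠ 0) :
    ∃ c e : S, e ≠ 0 ∧ a * e = b * c := by
  obtain ⟨c, e, he, h⟩ := frac ((ι b)⁻¹ * ι a)
  refine ⟨c, e, he, hι ?_⟩
  have hb' : ι b ≠ 0 := (map_ne_zero_iff ι hι).2 hb
  have he' : ι e ≠ 0 := (map_ne_zero_iff ι hι).2 he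
  rw [eq_mul_inv_iff_mul_eq₀ he', mul_assoc, inv_mul_eq_iff_eq_mul₀ hb'] at h
  simpa using h

/-- A multiplicative map on `S` which does not vanish on nonzero elements extends to the division
ring of right fractions of `S`. -/
theorem exists_monoidWithZeroHom_extension {ι : S →+* D} (hι : Function.Injective ι)
    (frac : ∀ d : D, ∃ a b : S, b ≠ 0 ∧ d = ι a * (ι b)⁻¹)
    {G : Type*} [GroupWithZero G] (f : S →*₀ G) (hf : ∀ s, s ≠ 0 → f s ≠ 0) :
    ∃ F : D →*₀ G, ∀ s, F (ι s) = f s := by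
  choose num den hden hnd using frac
  have frac : ∀ d : D, ∃ a b : S, b ≠ 0 ∧ d = ι a * (ι b)⁻¹ := fun d ↦ ⟨_, _, hden d, hnd d⟩
  have hι0 : ∀ {s}, s ≠ 0 → ι s ≠ 0 := fun h ↦ (map_ne_zero_iff ι hι).2 h
  have key : ∀ (d : D) (a b : S), b ≠ 0 → d = ι a * (ι b)⁻¹ →
      f (num d) * (f (den d))⁻¹ = f a * (f b)⁻¹ := by
    intro d a b hb hd
    obtain ⟨c, e, he, h⟩ := exists_common_multiple hι frac b (den d) (hden d)
    have hc : c ≠ 0 := by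
      rintro rfl
      rw [mul_zero] at h
      have := congrArg ι h
      rw [map_mul, map_zero] at this
      exact mul_ne_zero (hι0 hb) (hι0 he) this
    have h1 : a * e = num d * c := by
      apply hι
      have e1 : ι a = d * ι b := by rw [hd, inv_mul_cancel_right₀ (hι0 hb)]
      have e2 : ι (num d) = d * ι (den d) :=
        ((eq_mul_inv_iff_mul_eq₀ (hι0 (hden d))).1 (hnd d)).symm
      rw [map_mul, map_mul, e1, e2, mul_assoc, mul_assoc, ← map_mul, ← map_mul, h]
    have h2 := congrArg f h
    have h3 := congrArg f h1
    simp only [map_mul] at h2 h3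
    have e1 : f (num d) = f a * f e * (f c)⁻¹ := by
      rw [h3, mul_inv_cancel_right₀ (hf _ hc)]
    have e2 : f (den d) = f b * f e * (f c)⁻¹ := by
      rw [h2, mul_inv_cancel_right₀ (hf _ hc)]
    have := hf _ hc
    have := hf _ he
    rw [e1, e2]
    simp only [mul_inv_rev, inv_inv, mul_assoc]
    rw [inv_mul_cancel_left₀ (hf _ hc), mul_inv_cancel_left₀ (hf _ he)]
  have one_ne : (1 : S) ≠ 0 := by
    intro h
    have := congrArg ι h
    simp at this
  refine ⟨⟨⟨fun d ↦ f (num d) * (f (den d))⁻¹, ?_⟩, ?_, ?_⟩, ?_⟩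
  · rw [key 0 0 1 one_ne (by simp)]
    simp
  · change f (num 1) * _ = 1
    rw [key 1 1 1 one_ne (by simp)]
    simp
  · intro d d'
    change f (num (d * d')) * _ = f (num d) * (f (den d))⁻¹ * (f (num d') * (f (den d'))⁻¹)
    obtain ⟨c, e, he, h⟩ := exists_common_multiple hι frac (num d') (den d) (hden d)
    have hne : den d' * e ≠ 0 := by
      intro h0
      have := congrArg ι h0
      rw [map_mul, map_zero] at this
      exact mul_ne_zero (hι0 (hden d')) (hι0 he) this
    have e1 : ι (num d') = ι (den d) * ι c * (ι e)⁻¹ := by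
      rw [← map_mul, ← h, map_mul, mul_inv_cancel_right₀ (hι0 he)]
    have e2 : f (num d') = f (den d) * f c * (f e)⁻¹ := by
      rw [← map_mul, ← h, map_mul, mul_inv_cancel_right₀ (hf _ he)]
    rw [key (d * d') (num d * c) (den d' * e) hne, e2]
    · simp only [map_mul, mul_inv_rev, mul_assoc]
      rw [inv_mul_cancel_left₀ (hf _ (hden d))]
    · conv_lhs => rw [hnd d, hnd d']
      rw [e1]
      simp only [map_mul, mul_inv_rev, mul_assoc]
      rw [inv_mul_cancel_left₀ (hι0 (hden d))]
  · intro s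
    change f (num (ι s)) * _ = _
    rw [key (ι s) s 1 one_ne (by simp)]
    simp

/-- An injective ring homomorphism to a division ring extends to the division ring of right
fractions. -/
theorem exists_ringHom_extension {ι : S →+* D} (hι : Function.Injective ι)
    (frac : ∀ d : D, ∃ a b : S, b ≠ 0 ∧ d = ι a * (ι b)⁻¹)
    {G : Type*} [DivisionRing G] (f : S →+* G) (hf : Function.Injective f) :
    ∃ F : D →+* G, ∀ s, F (ι s) = f s := by
  obtain ⟨F, hF⟩ := exists_monoidWithZeroHom_extension hι frac f.toMonoidWithZeroHom
    fun s hs ↦ (map_ne_zero_iff f hf).2 hs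
  have hF : ∀ s, F (ι s) = f s := hF
  refine ⟨{ F with map_zero' := map_zero F, map_add' := ?_ }, hF⟩
  intro d d'
  change F (d + d') = F d + F d'
  have hι0 : ∀ {s}, s ≠ 0 → ι s ≠ 0 := fun h ↦ (map_ne_zero_iff ι hι).2 h
  obtain ⟨a, b, hb, rfl⟩ := frac d
  obtain ⟨a', b', hb', rfl⟩ := frac d'
  obtain ⟨c, e, he, h⟩ := exists_common_multiple hι frac b' b hb
  have h' := congrArg ι h
  rw [map_mul, map_mul] at h'
  have hc : ι c ≠ 0 := by
    intro h0
    rw [h0, mul_zero] at h'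
    exact mul_ne_zero (hι0 hb') (hι0 he) h'
  have e1 : ι a * (ι b)⁻¹ = ι (a * c) * (ι (b * c))⁻¹ := by
    simp only [map_mul, mul_inv_rev, mul_assoc]
    rw [mul_inv_cancel_left₀ hc]
  have e2 : ι a' * (ι b')⁻¹ = ι (a' * e) * (ι (b * c))⁻¹ := by
    rw [← h]
    simp only [map_mul, mul_inv_rev, mul_assoc]
    rw [mul_inv_cancel_left₀ (hι0 he)]
  rw [e1, e2]
  generalize (ι (b * c))⁻¹ = z
  rw [← add_mul, ← map_add, map_mul F, map_mul F, map_mul F, hF, hF, hF, map_add, add_mul]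

end OreExtension

section HahnInverse

namespace HahnSeries

variable {Γ R : Type*} [AddCommGroup Γ] [LinearOrder Γ] [IsOrderedAddMonoid Γ]

theorem finite_setOf_coeff_pow_ne_zero [Ring R] {x : HahnSeries Γ R} (hx : 0 < x.orderTop)
    (g : Γ) : {a : ℕ | (x ^ a).coeff g ≠ 0}.Finite := by
  have hpwo : Set.IsPWO (⋃ n, support (x ^ n)) :=
    SummableFamily.isPWO_iUnion_support_powers (zero_le_orderTop_iff.mp hx.le)
  by_cases h0 : x = 0
  · exact h0 ▸ Set.Finite.subset (Set.finite_singleton 0) (SummableFamily.co_support_zero g)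
  by_cases hg : g ∈ ⋃ n : ℕ, { g | (x ^ n).coeff g ≠ 0 }
  swap
  · exact Set.finite_empty.subset fun n hn => hg (Set.mem_iUnion.2 ⟨n, hn⟩)
  apply hpwo.isWF.induction hg
  intro y ys hy
  refine ((((Finset.antidiagonal x.isPWO_support hpwo y).finite_toSet.biUnion
    fun ij hij => hy ij.snd (Finset.mem_antidiagonal.1 (Finset.mem_coe.1 hij)).2.1 ?_).image
      Nat.succ).union (Set.finite_singleton 0)).subset ?_
  · obtain ⟨hi, _, rfl⟩ := Finset.mem_antidiagonal.1 (Finset.mem_coe.1 hij)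
    exact lt_add_of_pos_left ij.2 <| lt_of_lt_of_le ((zero_lt_orderTop_iff h0).mp hx) <|
      order_le_of_coeff_ne_zero <| Function.mem_support.mp hi
  · rintro (_ | n) hn
    · exact Set.mem_union_right _ (Set.mem_singleton 0)
    · rw [Set.mem_ofPred_eq, pow_succ'] at hn
      obtain ⟨i, hi, j, hj, rfl⟩ := support_mul_subset hn
      refine Set.mem_union_left _ ⟨n, Set.mem_iUnion.2 ⟨⟨i, j⟩, Set.mem_iUnion.2 ⟨?_, hj⟩⟩, rfl⟩
      exact Finset.mem_coe.2 (Finset.mem_antidiagonal.2 ⟨hi, Set.mem_iUnion.2 ⟨n, hj⟩, rfl⟩)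

/-- The geometric series of a Hahn series of positive order, over an arbitrary ring. -/
noncomputable def geomFamily [Ring R] (x : HahnSeries Γ R) (hx : 0 < x.orderTop) :
    SummableFamily Γ R ℕ where
  toFun n := x ^ n
  isPWO_iUnion_support' :=
    SummableFamily.isPWO_iUnion_support_powers (zero_le_orderTop_iff.mp hx.le)
  finite_co_support' g := finite_setOf_coeff_pow_ne_zero hx g

theorem geomFamily_apply [Ring R] (x : HahnSeries Γ R) (hx : 0 < x.orderTop) (n : ℕ) :
    geomFamily x hx n = x ^ n := rfl

theorem one_sub_mul_hsum_geomFamily [Ring R] {x : HahnSeries Γ R} (hx : 0 < x.orderTop) :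
    (1 - x) * (geomFamily x hx).hsum = 1 := by
  have h : (x • geomFamily x hx).embDomain ⟨Nat.succ, Nat.succ_injective⟩ =
      geomFamily x hx - SummableFamily.ofFinsupp (Finsupp.single 0 1) := by
    apply SummableFamily.ext
    rintro (_ | n)
    · simp [geomFamily_apply]
    · simp [SummableFamily.embDomain_apply, HahnSeries.of_symm_smul_of_eq_mul, geomFamily_apply,
        pow_succ', -smul_eq_mul]
  rw [sub_mul, one_mul, ← SummableFamily.hsum_smul,
    ← SummableFamily.hsum_embDomain (x • geomFamily x hx) ⟨Nat.succ, Nat.succ_injective⟩, h,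
    SummableFamily.hsum_sub]
  simp

/-- A nonzero Hahn series over a division ring is invertible, and its inverse lies in every
subring that is defined by conditions on the coefficients and contains the series together with
the inverse of its leading term. -/
theorem exists_mul_eq_one [DivisionRing R] (M : Γ → AddSubgroup R)
    (T : Subring (HahnSeries Γ R)) (hT : ∀ f, f ∈ T ↔ ∀ g, f.coeff g ∈ M g)
    {f : HahnSeries Γ R} (hf : f ≠ 0) (hfT : f ∈ T)
    (hinv : single (-f.order) f.leadingCoeff⁻¹ ∈ T) : ∃ f' ∈ T, f * f' = 1 := by
  set s := single (-f.order) f.leadingCoeff⁻¹ with hs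
  have hlc : f.leadingCoeff ≠ 0 := leadingCoeff_ne_zero.2 hf
  have hpos : 0 < (1 - f * s).orderTop := by
    have h1 : f * s ≠ 0 := mul_ne_zero hf (by simpa [hs] using hlc)
    have hord : (f * s).order = 0 := by
      rw [order_mul hf (by simpa [hs] using hlc), order_single (by simpa using hlc)]
      simp
    have hlead : (f * s).coeff 0 = 1 := by
      have := coeff_mul_single_add (r := f.leadingCoeff⁻¹) (x := f) (a := f.order) (b := -f.order)
      rw [add_neg_cancel] at this
      rw [hs, this, ← leadingCoeff_eq, mul_inv_cancel₀ hlc]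
    have : (f * s - 1).orderTop = (1 - f * s).orderTop := by rw [← orderTop_neg, neg_sub]
    by_cases h0 : 1 - f * s = 0
    · simp [h0]
    rw [zero_lt_orderTop_iff h0]
    refine lt_of_le_of_ne ?_ fun h ↦ ?_
    · by_contra hlt
      push Not at hlt
      have hc : (1 - f * s).coeff (1 - f * s).order ≠ 0 := coeff_order_eq_zero.not.2 h0
      apply hc
      rw [coeff_sub, coeff_one, if_neg hlt.ne,
        coeff_eq_zero_of_lt_order (hord.symm ▸ hlt), sub_zero]
    · have hc : (1 - f * s).coeff (1 - f * s).order ≠ 0 := coeff_order_eq_zero.not.2 h0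
      rw [← h] at hc
      simp [hlead] at hc
  have hx : 1 - f * s ∈ T := T.sub_mem T.one_mem (T.mul_mem hfT hinv)
  refine ⟨s * (geomFamily _ hpos).hsum, T.mul_mem hinv ((hT _).2 fun g ↦ ?_), ?_⟩
  · rw [SummableFamily.coeff_hsum]
    exact finsum_induction (· ∈ M g) (M g).zero_mem (fun _ _ ↦ (M g).add_mem)
      fun n ↦ (hT _).1 (T.pow_mem hx n) g
  · have := one_sub_mul_hsum_geomFamily hpos
    rwa [sub_sub_cancel, mul_assoc] at this

/-- Hahn series over a division ring with exponents in a linearly ordered abelian group form a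
division ring. -/
noncomputable abbrev divisionRing [DivisionRing R] : DivisionRing (HahnSeries Γ R) :=
  DivisionRing.ofIsUnitOrEqZero fun f ↦ by
    refine or_iff_not_imp_right.2 fun hf ↦ ?_
    obtain ⟨f', -, h⟩ := exists_mul_eq_one (fun _ ↦ ⊤) ⊤ (fun _ ↦ by simp) hf trivial trivial
    exact IsUnit.of_mul_eq_one _ h

end HahnSeries

end HahnInverse

namespace MvPolynomial

variable {σ k : Type*} [Field k]

/-- Translation of the variables by a vector of scalars. -/
noncomputable def translate (v : σ → k) : MvPolynomial σ k →ₐ[k] MvPolynomial σ k :=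
  aeval fun i ↦ X i + C (v i)

@[simp]
theorem translate_X (v : σ → k) (i : σ) : translate v (X i) = X i + C (v i) := by
  simp [translate]

@[simp]
theorem translate_C (v : σ → k) (c : k) : translate v (C c) = C c := by
  simp [translate]

theorem eval_translate (v w : σ → k) (p : MvPolynomial σ k) :
    eval w (translate v p) = eval (w + v) p := by
  induction p using MvPolynomial.induction_on with
  | C a => simp
  | add p q hp hq => simp [hp, hq]
  | mul_X p i hp => simp [hp]

variable (m : MonomialOrder σ)

theorem lt_of_mem_support_translate_monomial_sub (v : σ → k) (s : σ →₀ ℕ) (c : k) :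
    ∀ t ∈ (translate v (monomial s c) - monomial s c).support, m.toSyn t < m.toSyn s := by
  classical
  induction s using Finsupp.induction_linear generalizing c with
  | zero =>
    intro t ht
    rw [← C_apply, translate_C] at ht
    simp at ht
  | add f g hf hg =>
    intro t ht
    have e : translate v (monomial (f + g) c) - monomial (f + g) c =
      (translate v (monomial f 1) - monomial f 1) * (translate v (monomial g c) - monomial g c)
      + (translate v (monomial f 1) - monomial f 1) * monomial g c +
      monomial f 1 * (translate v (monomial g c) - monomial g c) := by
      have : monomial (f + g) c = monomial f 1 * monomial g c := by simp [monomial_mul]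
      rw [this, map_mul]; ring
    rw [e] at ht
    rcases Finset.mem_union.1 (support_add ht) with ht | ht
    · rcases Finset.mem_union.1 (support_add ht) with ht | ht
      · obtain ⟨a, ha, b, hb, rfl⟩ := Finset.mem_add.1 (support_mul _ _ ht)
        rw [map_add, map_add]
        exact add_lt_add (hf _ _ ha) (hg _ _ hb)
      · obtain ⟨a, ha, b, hb, rfl⟩ := Finset.mem_add.1 (support_mul _ _ ht)
        rw [map_add, map_add, Finset.mem_singleton.1 (support_monomial_subset hb)]
        exact add_lt_add_of_lt_of_le (hf _ _ ha) le_rfl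
    · obtain ⟨a, ha, b, hb, rfl⟩ := Finset.mem_add.1 (support_mul _ _ ht)
      rw [map_add, map_add, Finset.mem_singleton.1 (support_monomial_subset ha)]
      exact add_lt_add_of_le_of_lt le_rfl (hg _ _ hb)
  | single i n =>
    induction n generalizing c with
    | zero =>
      intro t ht
      rw [Finsupp.single_zero, ← C_apply, translate_C] at ht
      simp at ht
    | succ n ih =>
      intro t ht
      have e : translate v (monomial (Finsupp.single i (n + 1)) c) -
        monomial (Finsupp.single i (n + 1)) c =
        (translate v (monomial (Finsupp.single i n) c) - monomial (Finsupp.single i n) c) *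
          monomial (Finsupp.single i 1) 1
        + v i • (translate v (monomial (Finsupp.single i n) c) - monomial (Finsupp.single i n) c)
        + v i • monomial (Finsupp.single i n) c := by
        have : monomial (Finsupp.single i (n + 1)) c = monomial (Finsupp.single i n) c * X i := by
          rw [X, monomial_mul, ← Finsupp.single_add, mul_one]
        rw [this, map_mul, translate_X, smul_eq_C_mul, smul_eq_C_mul, ← X]; ring
      have hlt : m.toSyn (Finsupp.single i n) < m.toSyn (Finsupp.single i (n + 1)) := by
        rw [Finsupp.single_add, map_add, lt_add_iff_pos_right]
        exact (m.toSyn_lt_iff_ne_zero).2 (by simp)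
      rw [e] at ht
      rcases Finset.mem_union.1 (support_add ht) with ht | ht
      · rcases Finset.mem_union.1 (support_add ht) with ht | ht
        · obtain ⟨a, ha, b, hb, rfl⟩ := Finset.mem_add.1 (support_mul _ _ ht)
          rw [Finsupp.single_add, map_add, map_add,
            Finset.mem_singleton.1 (support_monomial_subset hb)]
          exact add_lt_add_of_lt_of_le (ih _ _ ha) le_rfl
        · exact (ih _ _ (support_smul ht)).trans hlt
      · rwa [Finset.mem_singleton.1 (support_monomial_subset (support_smul ht))]

theorem lt_degree_of_mem_support_translate_sub (v : σ → k) (p : MvPolynomial σ k) :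
    ∀ t ∈ (translate v p - p).support, m.toSyn t < m.toSyn (m.degree p) := by
  classical
  intro t ht
  have e : translate v p - p =
      ∑ s ∈ p.support, (translate v (monomial s (coeff s p)) - monomial s (coeff s p)) := by
    rw [Finset.sum_sub_distrib, ← map_sum, support_sum_monomial_coeff]
  rw [e] at ht
  obtain ⟨s, hs, hst⟩ := Finset.mem_biUnion.1 (support_sum ht)
  exact (lt_of_mem_support_translate_monomial_sub m v s _ t hst).trans_le (m.le_degree hs)

theorem degree_translate_sub_lt (v : σ → k) {p : MvPolynomial σ k} (h : translate v p - p ≠ 0) :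
    m.toSyn (m.degree (translate v p - p)) < m.toSyn (m.degree p) :=
  lt_degree_of_mem_support_translate_sub m v p _ (m.degree_mem_support h)

theorem leadingCoeff_translate (v : σ → k) (p : MvPolynomial σ k) :
    m.leadingCoeff (translate v p) = m.leadingCoeff p := by
  by_cases h : translate v p - p = 0
  · rw [sub_eq_zero.1 h]
  · have := m.leadingCoeff_add_of_lt (degree_translate_sub_lt m v h)
    rwa [add_comm, sub_add_cancel] at this

theorem eq_C_of_translate_single_eq [CharZero k] [DecidableEq σ] [Finite σ] {p : MvPolynomial σ k}
    (h : ∀ i, translate (Pi.single i 1) p = p) : ∃ c, p = C c := by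
  refine ⟨eval 0 p, funext_set (fun _ ↦ Set.range (Nat.cast : ℕ → k))
    (fun _ ↦ Set.infinite_range_of_injective Nat.cast_injective) fun x hx ↦ ?_⟩
  cases nonempty_fintype σ
  have h1 : ∀ i w, eval (w + Pi.single i 1) p = eval w p := fun i w ↦ by
    rw [← eval_translate, h]
  have h2 : ∀ i (n : ℕ) w, eval (w + Pi.single i (n : k)) p = eval w p := fun i n ↦ by
    induction n with
    | zero => simp
    | succ n ih =>
      intro w
      rw [Nat.cast_succ, Pi.single_add, ← add_assoc, h1, ih]
  have h3 : ∀ s : Finset σ, eval (∑ i ∈ s, Pi.single i (x i)) p = eval 0 p := fun s ↦ by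
    induction s using Finset.induction_on with
    | empty => simp
    | insert i s hi ih =>
      obtain ⟨n, hn⟩ := hx i trivial
      rw [Finset.sum_insert hi, add_comm, ← hn, h2, ih]
  rw [eval_C, ← h3 Finset.univ, Finset.univ_sum_single]

end MvPolynomial

/-- A division ring `D` together with a polynomial subalgebra `MvPolynomial σ k` and units `m g`
acting on it by translations, which form a group modulo the central subgroup `L` of scalars. -/
structure TranslationData (k D Γ σ : Type*) [Field k] [DivisionRing D] [Algebra k D]
    [AddCommGroup Γ] (L : Subgroup kˣ) (wt : Γ → σ → k) where
  poly : MvPolynomial σ k →ₐ[k] D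
  poly_injective : Function.Injective poly
  m : Γ → D
  m_ne_zero : ∀ g, m g ≠ 0
  conj : ∀ g p, m g * poly p = poly (MvPolynomial.translate (wt g) p) * m g
  m_mul : ∀ g h, ∃ l ∈ L, m g * m h = (l : k) • m (g + h)
  one_eq : ∃ l ∈ L, (1 : D) = (l : k) • m 0

namespace TranslationData

open HahnSeries

variable {k D Γ σ : Type*} [Field k] [DivisionRing D] [Algebra k D]

section Group

variable [AddCommGroup Γ] {L : Subgroup kˣ} {wt : Γ → σ → k} (X : TranslationData k D Γ σ L wt)

/-- The homogeneous component of degree `g`. -/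
noncomputable def component (g : Γ) : Submodule k D :=
  LinearMap.range ((LinearMap.mulRight k (X.m g)).comp X.poly.toLinearMap)

theorem mem_component {g : Γ} {d : D} : d ∈ X.component g ↔ ∃ p, d = X.poly p * X.m g := by
  simp [component, eq_comm]

theorem mul_m_mul (p q : MvPolynomial σ k) (g h : Γ) : ∃ l ∈ L,
    X.poly p * X.m g * (X.poly q * X.m h) =
      X.poly ((l : k) • (p * MvPolynomial.translate (wt g) q)) * X.m (g + h) := by
  obtain ⟨l, hl, e⟩ := X.m_mul g h
  refine ⟨l, hl, ?_⟩
  rw [mul_assoc, ← mul_assoc (X.m g), X.conj, mul_assoc _ (X.m g), e]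
  simp [mul_assoc]

theorem mul_mem_component {g h : Γ} {a b : D} (ha : a ∈ X.component g) (hb : b ∈ X.component h) :
    a * b ∈ X.component (g + h) := by
  obtain ⟨p, rfl⟩ := X.mem_component.1 ha
  obtain ⟨q, rfl⟩ := X.mem_component.1 hb
  obtain ⟨l, -, e⟩ := X.mul_m_mul p q g h
  exact X.mem_component.2 ⟨_, e⟩

theorem algebraMap_mem_component (c : k) : algebraMap k D c ∈ X.component 0 := by
  obtain ⟨l, -, e⟩ := X.one_eq
  refine X.mem_component.2 ⟨MvPolynomial.C (c * l), ?_⟩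
  rw [← mul_one (algebraMap k D c), e, ← MvPolynomial.algebraMap_eq, AlgHom.commutes, map_mul,
    mul_assoc, Algebra.smul_def]

end Group

section Order

variable [AddCommGroup Γ] [LinearOrder Γ] {L : Subgroup kˣ} {wt : Γ → σ → k}
  (X : TranslationData k D Γ σ L wt)

variable (mo : MonomialOrder σ)

/-- The leading coefficient of the lowest coefficient of a Hahn series. -/
noncomputable def symb (f : HahnSeries Γ D) : k :=
  mo.leadingCoeff (Function.invFun X.poly (f.leadingCoeff * (X.m f.order)⁻¹))

theorem symb_eq {f : HahnSeries Γ D} {p : MvPolynomial σ k}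
    (h : f.leadingCoeff = X.poly p * X.m f.order) : X.symb mo f = mo.leadingCoeff p := by
  rw [symb, h, mul_inv_cancel_right₀ (X.m_ne_zero _),
    Function.leftInverse_invFun X.poly_injective]

theorem symb_zero : X.symb mo 0 = 0 := by
  rw [X.symb_eq mo (p := 0) (by simp), mo.leadingCoeff_zero]

variable [IsOrderedAddMonoid Γ]

/-- The Hahn series whose coefficients are homogeneous of the appropriate degree. -/
noncomputable def hahnSubring : Subring (HahnSeries Γ D) where
  carrier := {f | ∀ g, f.coeff g ∈ X.component g}
  mul_mem' {a b} ha hb g := by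
    rw [coeff_mul]
    refine Submodule.sum_mem _ fun ij hij ↦ ?_
    rw [← (Finset.mem_antidiagonal.1 hij).2.2]
    exact X.mul_mem_component (ha _) (hb _)
  one_mem' g := by
    rw [coeff_one]
    split_ifs with h
    · rw [h, ← map_one (algebraMap k D)]
      exact X.algebraMap_mem_component 1
    · exact zero_mem _
  add_mem' ha hb g := by
    rw [coeff_add]
    exact add_mem (ha g) (hb g)
  zero_mem' g := zero_mem _
  neg_mem' ha g := by
    rw [coeff_neg]
    exact neg_mem (ha g)

theorem single_mem_hahnSubring {g : Γ} {d : D} (hd : d ∈ X.component g) :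
    single g d ∈ X.hahnSubring := fun h ↦ by
  rw [coeff_single]
  split_ifs with e
  · rwa [e]
  · exact zero_mem _

theorem exists_leadingCoeff_eq {f : HahnSeries Γ D} (hf : f ∈ X.hahnSubring) :
    ∃ p, f.leadingCoeff = X.poly p * X.m f.order := by
  rw [leadingCoeff_eq]
  exact X.mem_component.1 (hf _)

theorem symb_C (c : k) : ∃ l ∈ L, X.symb mo (C (algebraMap k D c)) = c * l := by
  obtain ⟨l, hl, e⟩ := X.one_eq
  refine ⟨l, hl, ?_⟩
  rw [X.symb_eq mo (p := MvPolynomial.C (c * l)), MonomialOrder.leadingCoeff_C]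
  rw [order_C, leadingCoeff_eq, order_C, ← MvPolynomial.algebraMap_eq, AlgHom.commutes, map_mul,
    mul_assoc, ← Algebra.smul_def (l : k), ← e, mul_one]
  simp

theorem symb_ne_zero {f : HahnSeries Γ D} (hf : f ∈ X.hahnSubring) (h : f ≠ 0) :
    X.symb mo f ≠ 0 := by
  obtain ⟨p, hp⟩ := X.exists_leadingCoeff_eq hf
  rw [X.symb_eq mo hp]
  rw [Ne, MonomialOrder.leadingCoeff_eq_zero_iff]
  rintro rfl
  exact h (leadingCoeff_eq_zero.1 (by simpa using hp))

theorem symb_mul {a b : HahnSeries Γ D} (ha : a ∈ X.hahnSubring) (hb : b ∈ X.hahnSubring) :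
    ∃ l ∈ L, X.symb mo (a * b) = l * (X.symb mo a * X.symb mo b) := by
  by_cases ha0 : a = 0
  · exact ⟨1, one_mem _, by simp [ha0, symb_zero]⟩
  by_cases hb0 : b = 0
  · exact ⟨1, one_mem _, by simp [hb0, symb_zero]⟩
  obtain ⟨p, hp⟩ := X.exists_leadingCoeff_eq ha
  obtain ⟨q, hq⟩ := X.exists_leadingCoeff_eq hb
  obtain ⟨l, hl, e⟩ := X.mul_m_mul p q a.order b.order
  refine ⟨l, hl, ?_⟩
  rw [X.symb_eq mo hp, X.symb_eq mo hq, X.symb_eq mo (p := (l : k) • (p *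
    MvPolynomial.translate (wt a.order) q)), MvPolynomial.smul_eq_C_mul,
    MonomialOrder.leadingCoeff_mul, MonomialOrder.leadingCoeff_C, MonomialOrder.leadingCoeff_mul,
    MvPolynomial.leadingCoeff_translate]
  rw [order_mul ha0 hb0, ← e, ← hp, ← hq, leadingCoeff_mul]

end Order

end TranslationData

/-- Every subgroup of units of a field is the preimage of `1` under a multiplicative map. -/
theorem exists_monoidWithZeroHom_units_eq_one_iff {k : Type u} [Field k] (L : Subgroup kˣ) :
    ∃ (G : Type u) (_ : CommGroupWithZero G) (π : k →*₀ G), ∀ u : kˣ, π u = 1 ↔ u ∈ L := by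
  classical
  refine ⟨WithZero (kˣ ⧸ L), inferInstance, (WithZero.map' (QuotientGroup.mk' L)).comp
    (WithZero.withZeroUnitsEquiv (G := k)).symm.toMonoidWithZeroHom, fun u ↦ ?_⟩
  change WithZero.map' (QuotientGroup.mk' L) (WithZero.withZeroUnitsEquiv.symm (u : k)) = 1 ↔ _
  rw [WithZero.withZeroUnitsEquiv_symm_apply_coe, WithZero.map'_coe, ← WithZero.coe_one,
    WithZero.coe_inj]
  exact QuotientGroup.eq_one_iff u

namespace TranslationData

open HahnSeries

section Group

variable {k D Γ σ : Type*} [Field k] [DivisionRing D] [Algebra k D] [AddCommGroup Γ]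
  {L : Subgroup kˣ} {wt : Γ → σ → k} (X : TranslationData k D Γ σ L wt)

theorem m_neg (g : Γ) : ∃ c : k, (X.m g)⁻¹ = c • X.m (-g) := by
  obtain ⟨l, -, e⟩ := X.m_mul g (-g)
  obtain ⟨l', -, e'⟩ := X.one_eq
  refine ⟨((l' * l⁻¹ : kˣ) : k), ?_⟩
  rw [inv_eq_iff_eq_inv, ← mul_eq_one_iff_eq_inv₀]
  · rw [mul_smul_comm, e, add_neg_cancel, smul_smul, e']
    simp
  · exact smul_ne_zero (Units.ne_zero _) (X.m_ne_zero _)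

theorem mem_component_of_isEmpty [IsEmpty σ] {g : Γ} {d : D} :
    d ∈ X.component g ↔ ∃ c : k, d = c • X.m g := by
  rw [mem_component]
  constructor
  · rintro ⟨p, rfl⟩
    rw [MvPolynomial.eq_C_of_isEmpty p, ← MvPolynomial.algebraMap_eq, AlgHom.commutes]
    exact ⟨_, (Algebra.smul_def _ _).symm⟩
  · rintro ⟨c, rfl⟩
    refine ⟨algebraMap _ _ c, ?_⟩
    rw [AlgHom.commutes, Algebra.smul_def]

theorem commute_of_mem_component [IsEmpty σ] {g : Γ} {a b : D} (ha : a ∈ X.component g)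
    (hb : b ∈ X.component (-g)) : Commute a b := by
  obtain ⟨c, rfl⟩ := X.mem_component_of_isEmpty.1 ha
  obtain ⟨c', rfl⟩ := X.mem_component_of_isEmpty.1 hb
  obtain ⟨d, hd⟩ := X.m_neg (-g)
  rw [neg_neg] at hd
  have hd0 : d ≠ 0 := by
    rintro rfl
    exact inv_ne_zero (X.m_ne_zero _) (by simpa using hd)
  have : X.m g = d⁻¹ • (X.m (-g))⁻¹ := by rw [hd, inv_smul_smul₀ hd0]
  rw [this]
  exact ((((Commute.refl _).inv_left₀).smul_left _).smul_left _).smul_right _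

end Group

variable {k D Γ σ S : Type*} [Field k] [DivisionRing D] [Algebra k D]
  [AddCommGroup Γ] [LinearOrder Γ] [IsOrderedAddMonoid Γ]
  {L : Subgroup kˣ} {wt : Γ → σ → k} (X : TranslationData k D Γ σ L wt)
  [Ring S] [Algebra k S]

theorem mem_of_mem_commutator (mo : MonomialOrder σ) {ι : S →ₐ[k] D}
    (hι : Function.Injective ι)
    (frac : ∀ d : D, ∃ a b : S, b ≠ 0 ∧ d = ι a * (ι b)⁻¹)
    {φ : S →+* HahnSeries Γ D} (hφ : Function.Injective φ) (hmem : ∀ s, φ s ∈ X.hahnSubring)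
    (hC : ∀ c, φ (algebraMap k S c) = C (algebraMap k D c)) {c : kˣ} {u : Dˣ}
    (hu : u ∈ commutator Dˣ) (h : (u : D) = algebraMap k D c) : c ∈ L := by
  obtain ⟨G, _, π, hπ⟩ := exists_monoidWithZeroHom_units_eq_one_iff L
  have hs (c : k) : π (X.symb mo (φ (algebraMap k S c))) = π c := by
    obtain ⟨l, hl, e⟩ := X.symb_C mo c
    rw [hC, e, map_mul, (hπ l).2 hl, mul_one]
  let f : S →*₀ G :=
    { toFun s := π (X.symb mo (φ s))
      map_zero' := by rw [map_zero, symb_zero, map_zero]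
      map_one' := by rw [← map_one (algebraMap k S), hs, map_one]
      map_mul' s t := by
        obtain ⟨l, hl, e⟩ := X.symb_mul mo (hmem s) (hmem t)
        rw [map_mul, e, map_mul, (hπ l).2 hl, map_mul, one_mul] }
  obtain ⟨F, hF⟩ := exists_monoidWithZeroHom_extension (ι := ι.toRingHom)
    (G := G) hι frac f fun s h0 ↦ (map_ne_zero π).2
      (X.symb_ne_zero mo (hmem s) ((map_ne_zero_iff φ hφ).2 h0))
  have h1 : Units.map (F : D →* G) u = 1 :=
    Abelianization.commutator_subset_ker (Units.map (F : D →* G) : Dˣ →* Gˣ) hu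
  rw [← hπ, ← hs, ← Units.val_one, ← h1]
  change f _ = F u
  rw [← hF, h]
  exact congrArg F (ι.commutes (c : k))

section Empty

variable [IsEmpty σ]

theorem coeff_zero_mul_comm {a b : HahnSeries Γ D} (ha : a ∈ X.hahnSubring)
    (hb : b ∈ X.hahnSubring) : (a * b).coeff 0 = (b * a).coeff 0 := by
  rw [coeff_mul, coeff_mul]
  refine Finset.sum_nbij' Prod.swap Prod.swap ?_ ?_ ?_ ?_ ?_
  · intro ij h
    have := Finset.mem_antidiagonal.1 h
    exact Finset.mem_antidiagonal.2 ⟨this.2.1, this.1, by rw [← this.2.2, add_comm]; rfl⟩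
  · intro ij h
    have := Finset.mem_antidiagonal.1 h
    exact Finset.mem_antidiagonal.2 ⟨this.2.1, this.1, by rw [← this.2.2, add_comm]; rfl⟩
  · intro ij _; rfl
  · intro ij _; rfl
  · intro ij h
    have h := (Finset.mem_antidiagonal.1 h).2.2
    have h' := hb ij.2
    rw [← neg_eq_of_add_eq_zero_right h] at h'
    have := X.commute_of_mem_component (ha ij.1) h'
    rw [neg_eq_of_add_eq_zero_right h] at this
    exact this

theorem eq_zero_of_mem_span_commutators {ι : S →ₐ[k] D} (hι : Function.Injective ι)
    (frac : ∀ d : D, ∃ a b : S, b ≠ 0 ∧ d = ι a * (ι b)⁻¹)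
    {φ : S →+* HahnSeries Γ D} (hφ : Function.Injective φ) (hmem : ∀ s, φ s ∈ X.hahnSubring)
    (hC : ∀ c, φ (algebraMap k S c) = C (algebraMap k D c)) {c : k}
    (hc : algebraMap k D c ∈ Submodule.span k {d : D | ∃ a b : D, d = a * b - b * a}) :
    c = 0 := by
  let := HahnSeries.divisionRing (Γ := Γ) (R := D)
  obtain ⟨F, hF⟩ := exists_ringHom_extension (ι := ι.toRingHom) hι frac φ hφ
  have hF' : ∀ s, F (ι s) = φ s := hF
  have hFC (c : k) : F (algebraMap k D c) = C (algebraMap k D c) := by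
    rw [← hC, ← hF', AlgHom.commutes]
  have hFmem (d : D) : F d ∈ X.hahnSubring := by
    obtain ⟨a, b, hb, rfl⟩ := frac d
    rw [map_mul, hF']
    refine mul_mem (hmem a) ?_
    have hb0 : φ b ≠ 0 := (map_ne_zero_iff φ hφ).2 hb
    obtain ⟨f', hf', e⟩ := exists_mul_eq_one (fun g ↦ (X.component g).toAddSubgroup)
      X.hahnSubring (fun _ ↦ Iff.rfl) hb0 (hmem b) (X.single_mem_hahnSubring (by
        obtain ⟨c, hc⟩ := X.mem_component_of_isEmpty.1 (hmem b (φ b).order)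
        obtain ⟨d, hd⟩ := X.m_neg (φ b).order
        rw [leadingCoeff_eq, hc, mem_component_of_isEmpty]
        exact ⟨c⁻¹ * d, by rw [smul_inv₀, hd, smul_smul]⟩))
    rw [map_inv₀, hF', ← eq_inv_of_mul_eq_one_right e]
    exact hf'
  have key (d : D) (hd : d ∈ Submodule.span k {d : D | ∃ a b : D, d = a * b - b * a}) :
      (F d).coeff 0 = 0 := by
    induction hd using Submodule.span_induction with
    | mem d hd =>
      obtain ⟨a, b, rfl⟩ := hd
      rw [map_sub, map_mul, map_mul, coeff_sub,
        X.coeff_zero_mul_comm (hFmem a) (hFmem b), sub_self]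
    | zero => rw [map_zero, coeff_zero]
    | add a b _ _ ha hb => rw [map_add, coeff_add, ha, hb, add_zero]
    | smul c a _ ha =>
      rw [Algebra.smul_def, map_mul, hFC, C_mul_eq_smul, coeff_smul, ha, smul_zero]
  have := key _ hc
  rw [hFC] at this
  simpa using this

end Empty

end TranslationData

/-- Pairwise commuting elements of an algebra are the images of the variables under an algebra
homomorphism from a polynomial algebra. -/
theorem exists_algHom_X_eq {k D σ : Type*} [Field k] [Ring D] [Algebra k D] (w : σ → D)
    (hw : ∀ i j, Commute (w i) (w j)) :
    ∃ Φ : MvPolynomial σ k →ₐ[k] D, ∀ i, Φ (MvPolynomial.X i) = w i := by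
  have := Algebra.isMulCommutative_adjoin k (s := Set.range w) (by
    rintro _ ⟨i, rfl⟩ _ ⟨j, rfl⟩
    exact hw i j)
  let A : Subalgebra k D := Algebra.adjoin k (Set.range w)
  let _ : CommRing A := { A.toRing with mul_comm := mul_comm' }
  exact ⟨A.val.comp (MvPolynomial.aeval fun i ↦ (⟨w i, Algebra.subset_adjoin ⟨i, rfl⟩⟩ : A)),
    fun i ↦ by simp⟩

theorem exists_monoidHom_single_eq {G ι : Type*} [Group G] [Fintype ι] [DecidableEq ι]
    (y : ι → G) (hy : ∀ i j, Commute (y i) (y j)) :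
    ∃ Θ : Multiplicative (ι → ℤ) →* G, ∀ i, Θ (Multiplicative.ofAdd (Pi.single i 1)) = y i := by
  let f := MonoidHom.noncommPiCoprod (fun i ↦ zpowersHom G (y i)) fun i j _ a b ↦ by
    simp only [zpowersHom_apply]
    exact (hy i j).zpow_zpow _ _
  let e : Multiplicative (ι → ℤ) →* (ι → Multiplicative ℤ) :=
    { toFun g i := Multiplicative.ofAdd (g.toAdd i)
      map_one' := rfl
      map_mul' _ _ := rfl }
  refine ⟨f.comp e, fun i ↦ ?_⟩
  have : e (Multiplicative.ofAdd (Pi.single i 1)) = Pi.mulSingle i (Multiplicative.ofAdd 1) := by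
    funext j
    by_cases h : j = i
    · subst h
      simp [e]
    · simp [e, h]
  rw [MonoidHom.comp_apply, this]
  exact (MonoidHom.noncommPiCoprod_mulSingle _ _ _).trans (zpow_one _)

section Scalars

variable {k D : Type*} [Field k] [DivisionRing D] [Algebra k D]

/-- The subgroup of units of an algebra formed by a group of scalars. -/
def scalarSubgroup (D : Type*) [DivisionRing D] [Algebra k D] (L : Subgroup kˣ) : Subgroup Dˣ :=
  L.map (Units.map (algebraMap k D : k →* D))

instance (L : Subgroup kˣ) : (scalarSubgroup D L).Normal where
  conj_mem a ha u := by
    obtain ⟨l, hl, rfl⟩ := ha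
    refine ⟨l, hl, ?_⟩
    rw [eq_mul_inv_iff_mul_eq]
    ext
    exact Algebra.commutes _ _

theorem exists_smul_eq_of_mk_eq {L : Subgroup kˣ} {u v : Dˣ}
    (h : (u : Dˣ ⧸ scalarSubgroup D L) = v) : ∃ l ∈ L, (u : D) = (l : k) • (v : D) := by
  obtain ⟨l, hl, e⟩ := QuotientGroup.eq.1 h.symm
  refine ⟨l, hl, ?_⟩
  rw [eq_inv_mul_iff_mul_eq] at e
  rw [← e, Algebra.smul_def, Algebra.commutes]
  rfl

theorem mk_eq_of_eq_smul {L : Subgroup kˣ} {u v : Dˣ} {l : kˣ} (hl : l ∈ L)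
    (h : (u : D) = (l : k) • (v : D)) : (u : Dˣ ⧸ scalarSubgroup D L) = v := by
  refine (QuotientGroup.eq.2 (Subgroup.mem_map.2 ⟨l, hl, ?_⟩)).symm
  rw [eq_inv_mul_iff_mul_eq]
  ext
  rw [h, Algebra.smul_def, Algebra.commutes]
  rfl

end Scalars

/-- Elements of an algebra satisfying the defining relations of `S_{n,r}^Λ(k)`. -/
structure IsMixedCrossedFamily {k D : Type*} [Field k] [Ring D] [Algebra k D] {n r : ℕ}
    (Λ : Matrix (Fin n) (Fin n) k) (hr : r ≤ n) (y : Fin n → D) (x : Fin r → D) : Prop where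
  yy : ∀ i j, y i * y j = Λ i j • (y j * y i)
  xy_same : ∀ i, x i * y (Fin.castLE hr i) = y (Fin.castLE hr i) * x i + 1
  xy_ne : ∀ i j, Fin.castLE hr i ≠ j → x i * y j = (Λ (Fin.castLE hr i) j)⁻¹ • (y j * x i)
  xx : ∀ i j, x i * x j = Λ (Fin.castLE hr i) (Fin.castLE hr j) • (x j * x i)

namespace Matrix.MulAntisymmetric

variable {k : Type*} [Field k] {n : ℕ} {Λ : Matrix (Fin n) (Fin n) k}

theorem ne_zero (hΛ : Λ.MulAntisymmetric) (i j : Fin n) : Λ i j ≠ 0 :=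
  left_ne_zero_of_mul_eq_one (hΛ.2 i j)

theorem inv_eq (hΛ : Λ.MulAntisymmetric) (i j : Fin n) : (Λ i j)⁻¹ = Λ j i :=
  inv_eq_of_mul_eq_one_right (hΛ.2 i j)

end Matrix.MulAntisymmetric

namespace IsMixedCrossedFamily

variable {k D : Type*} [Field k] [Ring D] [Algebra k D] {n r : ℕ}
  {Λ : Matrix (Fin n) (Fin n) k} {hr : r ≤ n} {y : Fin n → D} {x : Fin r → D}

theorem y_mul_same (H : IsMixedCrossedFamily Λ hr y x) (i : Fin r) :
    y (Fin.castLE hr i) * (y (Fin.castLE hr i) * x i) =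
      (y (Fin.castLE hr i) * x i - 1) * y (Fin.castLE hr i) := by
  rw [sub_mul, one_mul, mul_assoc _ (x i), H.xy_same, mul_add, mul_one, add_sub_cancel_right]

theorem y_commute_ne (hΛ : Λ.MulAntisymmetric) (H : IsMixedCrossedFamily Λ hr y x) {i : Fin r}
    {j : Fin n} (hij : Fin.castLE hr i ≠ j) : Commute (y j) (y (Fin.castLE hr i) * x i) := by
  rw [commute_iff_eq, ← mul_assoc, H.yy, mul_assoc _ (x i), H.xy_ne i j hij, smul_mul_assoc,
    mul_smul_comm, mul_assoc, hΛ.inv_eq]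

theorem commute (hΛ : Λ.MulAntisymmetric) (H : IsMixedCrossedFamily Λ hr y x) (i j : Fin r) :
    Commute (y (Fin.castLE hr i) * x i) (y (Fin.castLE hr j) * x j) := by
  rcases eq_or_ne i j with rfl | hij
  · exact Commute.refl _
  have hij' : Fin.castLE hr i ≠ Fin.castLE hr j := (Fin.castLE_injective hr).ne hij
  refine (y_commute_ne hΛ H hij'.symm).mul_left ?_
  rw [commute_iff_eq, ← mul_assoc, H.xy_ne i _ hij', smul_mul_assoc, mul_assoc, H.xx i j,
    mul_smul_comm, smul_smul, inv_mul_cancel₀ (hΛ.ne_zero _ _), one_smul, mul_assoc]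

theorem map {B : Type*} [Ring B] [Algebra k B] (f : D →ₐ[k] B)
    (H : IsMixedCrossedFamily Λ hr y x) : IsMixedCrossedFamily Λ hr (f ∘ y) (f ∘ x) where
  yy i j := by simpa using congrArg f (H.yy i j)
  xy_same i := by simpa using congrArg f (H.xy_same i)
  xy_ne i j hij := by simpa using congrArg f (H.xy_ne i j hij)
  xx i j := by simpa using congrArg f (H.xx i j)

end IsMixedCrossedFamily

/-- The subgroup of units generated by the entries of `Λ`. -/
abbrev Matrix.entrySubgroup {k : Type*} [Field k] {n : ℕ} (Λ : Matrix (Fin n) (Fin n) k) :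
    Subgroup kˣ :=
  Subgroup.closure {x : kˣ | ∃ i j : Fin n, (x : k) = Λ i j}

theorem IsMixedCrossedFamily.exists_translationData {k D : Type*} [Field k] [CharZero k]
    [DivisionRing D] [Algebra k D] {n r : ℕ} {Λ : Matrix (Fin n) (Fin n) k} {hr : r ≤ n}
    {y : Fin n → D} {x : Fin r → D} (hΛ : Λ.MulAntisymmetric)
    (H : IsMixedCrossedFamily Λ hr y x) (hy : ∀ i, y i ≠ 0) :
    ∃ X : TranslationData k D (Fin n → ℤ) (Fin r) Λ.entrySubgroup
      (fun g i ↦ -(g (Fin.castLE hr i) : k)),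
      (∀ i, y i ∈ X.component (Pi.single i 1)) ∧
      ∀ i, x i ∈ X.component (-Pi.single (Fin.castLE hr i) 1) := by
  obtain ⟨Φ, hΦ⟩ := exists_algHom_X_eq (k := k) _ (H.commute hΛ)
  set w : Fin r → D := fun i ↦ y (Fin.castLE hr i) * x i with hw
  set L := Λ.entrySubgroup
  let Y (i : Fin n) : Dˣ := Units.mk0 (y i) (hy i)
  obtain ⟨Θ, hΘ⟩ := exists_monoidHom_single_eq
    (fun i ↦ (Y i : Dˣ ⧸ scalarSubgroup D L)) fun i j ↦ by
      rw [commute_iff_eq, ← QuotientGroup.mk_mul, ← QuotientGroup.mk_mul]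
      exact mk_eq_of_eq_smul (l := Units.mk0 _ (hΛ.ne_zero i j))
        (Subgroup.subset_closure ⟨i, j, rfl⟩) (H.yy i j)
  have hex : ∀ g : Fin n → ℤ, ∃ u : Dˣ, (u : Dˣ ⧸ scalarSubgroup D L) =
      Θ (Multiplicative.ofAdd g) ∧ ∀ i, (u : D) * w i =
        (w i - algebraMap k D (g (Fin.castLE hr i))) * u := by
    let A : AddSubgroup (Fin n → ℤ) :=
      { carrier := {g | ∃ u : Dˣ, (u : Dˣ ⧸ scalarSubgroup D L) =
          Θ (Multiplicative.ofAdd g) ∧ ∀ i, (u : D) * w i =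
          (w i - algebraMap k D (g (Fin.castLE hr i))) * u}
        zero_mem' := ⟨1, by simp, by simp⟩
        add_mem' := by
          rintro g h ⟨u, hu, hu'⟩ ⟨v, hv, hv'⟩
          refine ⟨u * v, by rw [QuotientGroup.mk_mul, hu, hv, ofAdd_add, map_mul], fun i ↦ ?_⟩
          rw [Units.val_mul, mul_assoc, hv', ← mul_assoc, mul_sub, hu', ← Algebra.commutes,
            ← sub_mul, mul_assoc, sub_sub, Pi.add_apply, Int.cast_add, map_add]
        neg_mem' := by
          rintro g ⟨u, hu, hu'⟩
          refine ⟨u⁻¹, by rw [QuotientGroup.mk_inv, hu, ofAdd_neg, map_inv], fun i ↦ ?_⟩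
          rw [Units.inv_mul_eq_iff_eq_mul, ← mul_assoc, Pi.neg_apply, Int.cast_neg, map_neg,
            sub_neg_eq_add, mul_add, hu', ← Algebra.commutes, ← add_mul, sub_add_cancel,
            Units.mul_inv_cancel_right] }
    intro g
    have hA : ∀ i, Pi.single i 1 ∈ A := fun j ↦ by
      refine ⟨Y j, (hΘ j).symm, fun i ↦ ?_⟩
      by_cases hij : Fin.castLE hr i = j
      · subst hij
        simpa [Y, hw] using H.y_mul_same i
      · rw [Pi.single_eq_of_ne hij]
        simpa [Y, hw] using (y_commute_ne hΛ H hij).eq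
    change g ∈ A
    rw [← Finset.univ_sum_single g]
    refine sum_mem fun i _ ↦ ?_
    have : Pi.single i (g i) = g i • (Pi.single i 1 : Fin n → ℤ) := by
      rw [← Pi.single_smul, smul_eq_mul, mul_one]
    rw [this]
    exact zsmul_mem (hA i) _
  choose m hm hmw using hex
  have hconj (g : Fin n → ℤ) (p : MvPolynomial (Fin r) k) : (m g : D) * Φ p =
      Φ (MvPolynomial.translate (fun i ↦ -(g (Fin.castLE hr i) : k)) p) * m g := by
    induction p using MvPolynomial.induction_on with
    | C a =>
      rw [MvPolynomial.translate_C, ← MvPolynomial.algebraMap_eq, AlgHom.commutes,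
        Algebra.commutes]
    | add p q hp hq => rw [map_add, mul_add, hp, hq, map_add, map_add, add_mul]
    | mul_X p i hp =>
      rw [map_mul, hΦ, ← mul_assoc, hp, mul_assoc, hmw, map_mul, map_mul, ← mul_assoc,
        MvPolynomial.translate_X, map_add, hΦ, map_neg, map_neg, ← MvPolynomial.algebraMap_eq,
        AlgHom.commutes, sub_eq_add_neg]
  have hinj : ∀ p, Φ p = 0 → p = 0 := by
    let mo : MonomialOrder (Fin r) := MonomialOrder.lex
    intro p
    induction hd : mo.toSyn (mo.degree p) using WellFoundedLT.induction generalizing p with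
    | ind d ih =>
      subst hd
      intro hp
      have htr (i : Fin r) : MvPolynomial.translate (Pi.single i 1) p = p := by
        by_contra hne
        have hne := sub_ne_zero.2 hne
        refine hne (ih _ (MvPolynomial.degree_translate_sub_lt mo _ hne) _ rfl ?_)
        rw [map_sub, hp, sub_zero]
        have := hconj (-Pi.single (Fin.castLE hr i) 1) p
        rw [hp, mul_zero] at this
        have e : (fun j ↦ -(((-Pi.single (Fin.castLE hr i) 1 : Fin n → ℤ) (Fin.castLE hr j) : ℤ)
            : k)) = Pi.single i 1 := by
          funext j
          by_cases hij : j = i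
          · subst hij
            simp
          · simp [hij]
        rw [e] at this
        exact (mul_eq_zero.1 this.symm).resolve_right (Units.ne_zero _)
      obtain ⟨c, rfl⟩ := MvPolynomial.eq_C_of_translate_single_eq htr
      rw [← MvPolynomial.algebraMap_eq, AlgHom.commutes] at hp
      rw [(map_eq_zero _).1 hp, map_zero]
  let X : TranslationData k D (Fin n → ℤ) (Fin r) Λ.entrySubgroup
      (fun g i ↦ -(g (Fin.castLE hr i) : k)) :=
    { poly := Φ
      poly_injective := (injective_iff_map_eq_zero Φ).2 hinj
      m g := m g
      m_ne_zero g := Units.ne_zero _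
      conj := hconj
      m_mul g h := exists_smul_eq_of_mk_eq (u := m g * m h) (by
        rw [QuotientGroup.mk_mul, hm, hm, hm, ofAdd_add, map_mul])
      one_eq := exists_smul_eq_of_mk_eq (u := 1) (by
        rw [hm, ofAdd_zero, map_one, QuotientGroup.mk_one]) }
  refine ⟨X, fun i ↦ ?_, fun i ↦ ?_⟩
  · obtain ⟨l, -, e⟩ := exists_smul_eq_of_mk_eq (u := Y i) (v := m (Pi.single i 1))
      (by rw [hm, hΘ])
    refine X.mem_component.2 ⟨algebraMap _ _ (l : k), ?_⟩
    rw [AlgHom.commutes, ← Algebra.smul_def]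
    exact e
  · obtain ⟨l, -, e⟩ := exists_smul_eq_of_mk_eq (u := (Y (Fin.castLE hr i))⁻¹)
      (v := m (-Pi.single (Fin.castLE hr i) 1))
      (by rw [hm, ofAdd_neg, map_inv, hΘ, QuotientGroup.mk_inv])
    refine X.mem_component.2 ⟨(MvPolynomial.X i + 1) * algebraMap _ _ (l : k), ?_⟩
    change _ = Φ _ * (m _ : D)
    rw [map_mul, mul_assoc, AlgHom.commutes, ← Algebra.smul_def, ← e, map_add, hΦ, map_one,
      ← H.xy_same]
    exact (Units.mul_inv_cancel_right (x i) (Y (Fin.castLE hr i))).symm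

namespace MixedCrossedAlgebra

variable {k : Type u} [Field k] {n : ℕ} {Λ : Matrix (Fin n) (Fin n) k} {r : ℕ} {hr : r ≤ n}

/-- The canonical projection from the free algebra. -/
noncomputable def proj (Λ : Matrix (Fin n) (Fin n) k) (hr : r ≤ n) :
    FreeAlgebra k (Fin n ⊕ Fin r) →ₐ[k] MixedCrossedAlgebra k Λ r hr :=
  RingQuot.mkAlgHom k (MixedCrossedRel k Λ r hr)

theorem proj_surjective : Function.Surjective (proj Λ hr) :=
  RingQuot.mkAlgHom_surjective k (MixedCrossedRel k Λ r hr)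

theorem proj_eq {a b : FreeAlgebra k (Fin n ⊕ Fin r)} (h : MixedCrossedRel k Λ r hr a b) :
    proj Λ hr a = proj Λ hr b :=
  RingQuot.mkAlgHom_rel k h

theorem proj_inl (i : Fin n) : proj Λ hr (FreeAlgebra.ι k (Sum.inl i)) = y k Λ r hr i := rfl

theorem proj_inr (i : Fin r) : proj Λ hr (FreeAlgebra.ι k (Sum.inr i)) = x k Λ r hr i := rfl

theorem isMixedCrossedFamily : IsMixedCrossedFamily Λ hr (y k Λ r hr) (x k Λ r hr) where
  yy i j := by
    simpa only [map_mul, proj_inl, AlgHom.commutes, Algebra.smul_def] using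
      proj_eq (MixedCrossedRel.yy (Λ := Λ) (hr := hr) i j)
  xy_same i := by
    simpa only [map_mul, map_add, map_one, proj_inl, proj_inr] using
      proj_eq (MixedCrossedRel.xy_same (Λ := Λ) (hr := hr) i)
  xy_ne i j hij := by
    simpa only [map_mul, proj_inl, proj_inr, AlgHom.commutes, Algebra.smul_def] using
      proj_eq (MixedCrossedRel.xy_ne (Λ := Λ) (hr := hr) i j hij)
  xx i j := by
    simpa only [map_mul, proj_inr, AlgHom.commutes, Algebra.smul_def] using
      proj_eq (MixedCrossedRel.xx (Λ := Λ) (hr := hr) i j)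

theorem exists_lift {B : Type*} [Ring B] [Algebra k B] {Y : Fin n → B} {X : Fin r → B}
    (H : IsMixedCrossedFamily Λ hr Y X) : ∃ φ : MixedCrossedAlgebra k Λ r hr →ₐ[k] B,
      (∀ i, φ (y k Λ r hr i) = Y i) ∧ ∀ i, φ (x k Λ r hr i) = X i := by
  let f : FreeAlgebra k (Fin n ⊕ Fin r) →ₐ[k] B := FreeAlgebra.lift k (Sum.elim Y X)
  have hf : ∀ ⦃a b⦄, MixedCrossedRel k Λ r hr a b → f a = f b := by
    rintro _ _ (⟨i, j⟩ | ⟨i⟩ | ⟨i, j, hij⟩ | ⟨i, j⟩)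
    · simpa [f, Algebra.smul_def] using H.yy i j
    · simpa [f] using H.xy_same i
    · simpa [f, Algebra.smul_def] using H.xy_ne i j hij
    · simpa [f, Algebra.smul_def] using H.xx i j
  let φ : MixedCrossedAlgebra k Λ r hr →ₐ[k] B := RingQuot.liftAlgHom k ⟨f, hf⟩
  have hφ : ∀ a, φ (proj Λ hr a) = f a := RingQuot.liftAlgHom_mkAlgHom_apply k f hf
  refine ⟨φ, fun i ↦ ?_, fun i ↦ ?_⟩
  · rw [← proj_inl, hφ]
    simp [f]
  · rw [← proj_inr, hφ]
    simp [f]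

theorem mem_of_generators_mem {p : MixedCrossedAlgebra k Λ r hr → Prop}
    (hC : ∀ c, p (algebraMap k _ c)) (hy : ∀ i, p (y k Λ r hr i)) (hx : ∀ i, p (x k Λ r hr i))
    (hmul : ∀ a b, p a → p b → p (a * b)) (hadd : ∀ a b, p a → p b → p (a + b))
    (s : MixedCrossedAlgebra k Λ r hr) : p s := by
  obtain ⟨a, rfl⟩ := proj_surjective s
  induction a with
  | grade0 c =>
    rw [AlgHom.commutes]
    exact hC c
  | grade1 i =>
    rcases i with i | i
    · exact hy i
    · exact hx i
  | mul a b ha hb =>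
    rw [map_mul]
    exact hmul _ _ ha hb
  | add a b ha hb =>
    rw [map_add]
    exact hadd _ _ ha hb

section Representation

/-- Half of the entries of `Λ`, replaced by `1` on and above the diagonal. -/
noncomputable def lowerEntry (Λ : Matrix (Fin n) (Fin n) k) (i j : Fin n) : k :=
  if j < i then Λ i j else 1

theorem lowerEntry_ne_zero (hΛ : Λ.MulAntisymmetric) (i j : Fin n) : lowerEntry Λ i j ≠ 0 := by
  unfold lowerEntry
  split_ifs
  · exact hΛ.ne_zero i j
  · exact one_ne_zero

theorem lowerEntry_self (i : Fin n) : lowerEntry Λ i i = 1 := by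
  simp [lowerEntry]

theorem lowerEntry_eq (hΛ : Λ.MulAntisymmetric) (i j : Fin n) :
    lowerEntry Λ i j = Λ i j * lowerEntry Λ j i := by
  unfold lowerEntry
  rcases lt_trichotomy i j with h | rfl | h
  · simp [h, h.not_gt, hΛ.2]
  · simp [hΛ.1]
  · simp [h, h.not_gt]

/-- The character of `ℤ^n` by which `y_i` acts, up to translation. -/
noncomputable def character (Λ : Matrix (Fin n) (Fin n) k) (i : Fin n) (h : Fin n → ℤ) : k :=
  ∏ j, lowerEntry Λ i j ^ h j

theorem character_ne_zero (hΛ : Λ.MulAntisymmetric) (i : Fin n) (h : Fin n → ℤ) :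
    character Λ i h ≠ 0 :=
  Finset.prod_ne_zero_iff.2 fun j _ ↦ zpow_ne_zero _ (lowerEntry_ne_zero hΛ i j)

theorem character_add_single (hΛ : Λ.MulAntisymmetric) (i j : Fin n) (h : Fin n → ℤ) :
    character Λ i (h + Pi.single j 1) = character Λ i h * lowerEntry Λ i j := by
  unfold character
  simp_rw [Pi.add_apply, zpow_add₀ (lowerEntry_ne_zero hΛ i _), Finset.prod_mul_distrib]
  congr 1
  rw [Finset.prod_eq_single j]
  · simp
  · intro l _ hl
    simp [hl]
  · simp

theorem character_sub_single (hΛ : Λ.MulAntisymmetric) (i j : Fin n) (h : Fin n → ℤ) :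
    character Λ i (h - Pi.single j 1) = character Λ i h * (lowerEntry Λ i j)⁻¹ := by
  rw [eq_mul_inv_iff_mul_eq₀ (lowerEntry_ne_zero hΛ i j), ← character_add_single hΛ,
    sub_add_cancel]

/-- The action of `y_i` on functions on `ℤ^n`. -/
noncomputable def yEnd (Λ : Matrix (Fin n) (Fin n) k) (i : Fin n) :
    Module.End k ((Fin n → ℤ) → k) where
  toFun f h := character Λ i h * f (h - Pi.single i 1)
  map_add' f g := by ext h; simp [mul_add]
  map_smul' c f := by ext h; simp [mul_left_comm]

/-- The action of `x_i` on functions on `ℤ^n`. -/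
noncomputable def xEnd (Λ : Matrix (Fin n) (Fin n) k) (i : Fin n) :
    Module.End k ((Fin n → ℤ) → k) where
  toFun f h := (character Λ i h)⁻¹ * (h i + 1) * f (h + Pi.single i 1)
  map_add' f g := by ext h; simp [mul_add]
  map_smul' c f := by ext h; simp [mul_left_comm]

theorem yEnd_apply (i : Fin n) (f : (Fin n → ℤ) → k) (h : Fin n → ℤ) :
    yEnd Λ i f h = character Λ i h * f (h - Pi.single i 1) := rfl

theorem xEnd_apply (i : Fin n) (f : (Fin n → ℤ) → k) (h : Fin n → ℤ) :
    xEnd Λ i f h = (character Λ i h)⁻¹ * (h i + 1) * f (h + Pi.single i 1) := rfl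

theorem isMixedCrossedFamily_end (hΛ : Λ.MulAntisymmetric) :
    IsMixedCrossedFamily Λ hr (yEnd Λ) (fun i ↦ xEnd Λ (Fin.castLE hr i)) where
  yy i j := by
    ext f h
    have h1 := lowerEntry_ne_zero hΛ i j
    have h2 := lowerEntry_ne_zero hΛ j i
    simp only [Module.End.mul_apply, yEnd_apply, LinearMap.smul_apply, Pi.smul_apply,
      character_sub_single hΛ, smul_eq_mul]
    rw [sub_right_comm h]
    field_simp
    rw [lowerEntry_eq hΛ i j]
    ring
  xy_same i := by
    ext f h
    have h1 := character_ne_zero hΛ (Fin.castLE hr i) h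
    simp only [Module.End.mul_apply, yEnd_apply, xEnd_apply, LinearMap.add_apply, Pi.add_apply,
      character_sub_single hΛ, character_add_single hΛ, lowerEntry_self, add_sub_cancel_right,
      sub_add_cancel, Module.End.one_apply, Pi.sub_apply, Pi.single_eq_same]
    field_simp
    push_cast
    ring
  xy_ne i j hij := by
    ext f h
    have h1 := lowerEntry_ne_zero hΛ (Fin.castLE hr i) j
    have h2 := lowerEntry_ne_zero hΛ j (Fin.castLE hr i)
    have h3 := character_ne_zero hΛ (Fin.castLE hr i) h
    have h4 := hΛ.ne_zero (Fin.castLE hr i) j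
    simp only [Module.End.mul_apply, yEnd_apply, xEnd_apply, LinearMap.smul_apply, Pi.smul_apply,
      character_sub_single hΛ, character_add_single hΛ, smul_eq_mul, Pi.sub_apply,
      Pi.single_eq_of_ne hij, sub_zero]
    rw [add_sub_right_comm h]
    field_simp
    rw [lowerEntry_eq hΛ (Fin.castLE hr i) j]
    ring
  xx i j := by
    rcases eq_or_ne i j with rfl | hij
    · rw [hΛ.1, one_smul]
    have hij : Fin.castLE hr i ≠ Fin.castLE hr j := (Fin.castLE_injective hr).ne hij
    ext f h
    have h1 := lowerEntry_ne_zero hΛ (Fin.castLE hr i) (Fin.castLE hr j)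
    have h2 := lowerEntry_ne_zero hΛ (Fin.castLE hr j) (Fin.castLE hr i)
    have h3 := character_ne_zero hΛ (Fin.castLE hr i) h
    have h4 := character_ne_zero hΛ (Fin.castLE hr j) h
    simp only [Module.End.mul_apply, xEnd_apply, LinearMap.smul_apply, Pi.smul_apply,
      character_add_single hΛ, smul_eq_mul, Pi.add_apply, Pi.single_eq_of_ne hij,
      Pi.single_eq_of_ne hij.symm, add_zero]
    rw [add_right_comm h]
    field_simp
    rw [lowerEntry_eq hΛ (Fin.castLE hr i) (Fin.castLE hr j)]
    ring

theorem y_ne_zero (hΛ : Λ.MulAntisymmetric) (i : Fin n) : y k Λ r hr i ≠ 0 := by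
  obtain ⟨φ, hφ, -⟩ := exists_lift (isMixedCrossedFamily_end (hr := hr) hΛ)
  intro h
  have := hφ i
  rw [h, map_zero] at this
  have := congrFun (LinearMap.congr_fun this 1) 0
  rw [yEnd_apply, Pi.one_apply, mul_one] at this
  exact character_ne_zero hΛ i 0 this.symm

end Representation

end MixedCrossedAlgebra

namespace HahnSeries

variable {Γ R : Type*} [AddCommGroup Γ] [LinearOrder Γ] [IsOrderedAddMonoid Γ] [Ring R]

/-- The inclusion of the group algebra into the ring of Hahn series. -/
noncomputable def ofAddMonoidAlgebra : AddMonoidAlgebra R Γ →+* HahnSeries Γ R :=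
  AddMonoidAlgebra.liftNCRingHom (C : R →+* HahnSeries Γ R)
    { toFun g := single g.toAdd 1
      map_one' := rfl
      map_mul' a b := by simp } fun r g ↦ by
        rw [commute_iff_eq]
        simp [C_apply]

theorem ofAddMonoidAlgebra_single (g : Γ) (r : R) :
    ofAddMonoidAlgebra (AddMonoidAlgebra.single g r) = single g r := by
  simp [ofAddMonoidAlgebra, C_apply]

theorem coeff_ofAddMonoidAlgebra (f : AddMonoidAlgebra R Γ) (g : Γ) :
    (ofAddMonoidAlgebra f).coeff g = f.coeff g := by
  classical
  induction f using AddMonoidAlgebra.induction_linear with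
  | zero => simp
  | add f h hf hh => simp [hf, hh]
  | single h r =>
    rw [ofAddMonoidAlgebra_single, coeff_single, AddMonoidAlgebra.coeff_single,
      Finsupp.single_apply]
    congr 1
    exact propext eq_comm

theorem ofAddMonoidAlgebra_injective :
    Function.Injective (ofAddMonoidAlgebra : AddMonoidAlgebra R Γ →+* HahnSeries Γ R) := by
  intro a b h
  ext g
  rw [← coeff_ofAddMonoidAlgebra, h, coeff_ofAddMonoidAlgebra]

end HahnSeries

theorem IsMixedCrossedFamily.single {k D : Type*} [Field k] [Ring D] [Algebra k D] {n r : ℕ}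
    {Λ : Matrix (Fin n) (Fin n) k} {hr : r ≤ n} {y : Fin n → D} {x : Fin r → D}
    {Γ : Type*} [AddCommGroup Γ] (e : Fin n → Γ) (H : IsMixedCrossedFamily Λ hr y x) :
    IsMixedCrossedFamily (D := AddMonoidAlgebra D Γ) Λ hr
      (fun i ↦ AddMonoidAlgebra.single (e i) (y i))
      (fun i ↦ AddMonoidAlgebra.single (-e (Fin.castLE hr i)) (x i)) where
  yy i j := by
    rw [AddMonoidAlgebra.single_mul_single, AddMonoidAlgebra.single_mul_single, H.yy,
      AddMonoidAlgebra.smul_single, add_comm]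
  xy_same i := by
    rw [AddMonoidAlgebra.single_mul_single, AddMonoidAlgebra.single_mul_single, H.xy_same,
      neg_add_cancel, add_neg_cancel, AddMonoidAlgebra.single_add, AddMonoidAlgebra.one_def]
  xy_ne i j hij := by
    rw [AddMonoidAlgebra.single_mul_single, AddMonoidAlgebra.single_mul_single, H.xy_ne i j hij,
      AddMonoidAlgebra.smul_single, add_comm]
  xx i j := by
    rw [AddMonoidAlgebra.single_mul_single, AddMonoidAlgebra.single_mul_single, H.xx,
      AddMonoidAlgebra.smul_single, add_comm]

theorem exists_hahn_embedding {k : Type u} [Field k] {n r : ℕ} {hr : r ≤ n}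
    {Λ : Matrix (Fin n) (Fin n) k} {D Γ σ : Type*} [DivisionRing D] [Algebra k D] [AddCommGroup Γ]
    [LinearOrder Γ] [IsOrderedAddMonoid Γ] {L : Subgroup kˣ} {wt : Γ → σ → k}
    (X : TranslationData k D Γ σ L wt) (e : Fin n → Γ) {ι : MixedCrossedAlgebra k Λ r hr →ₐ[k] D}
    (hι : Function.Injective ι) (hy : ∀ i, ι (.y k Λ r hr i) ∈ X.component (e i))
    (hx : ∀ i, ι (.x k Λ r hr i) ∈ X.component (-e (Fin.castLE hr i))) :
    ∃ φ : MixedCrossedAlgebra k Λ r hr →+* HahnSeries Γ D, Function.Injective φ ∧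
      (∀ s, φ s ∈ X.hahnSubring) ∧
      ∀ c, φ (algebraMap k _ c) = HahnSeries.C (algebraMap k D c) := by
  obtain ⟨φ, hφy, hφx⟩ := MixedCrossedAlgebra.exists_lift
    ((MixedCrossedAlgebra.isMixedCrossedFamily.map ι).single e)
  have hA (c : k) : algebraMap k (AddMonoidAlgebra D Γ) c =
      AddMonoidAlgebra.single 0 (algebraMap k D c) := by
    rw [Algebra.algebraMap_eq_smul_one, AddMonoidAlgebra.one_def, AddMonoidAlgebra.smul_single,
      Algebra.algebraMap_eq_smul_one]
  have hC (c : k) : HahnSeries.ofAddMonoidAlgebra (φ (algebraMap k _ c)) =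
      HahnSeries.C (Γ := Γ) (algebraMap k D c) := by
    rw [AlgHom.commutes, hA, HahnSeries.C_apply]
    exact HahnSeries.ofAddMonoidAlgebra_single _ _
  let ε : AddMonoidAlgebra D Γ →+* D :=
    AddMonoidAlgebra.liftNCRingHom (RingHom.id D) 1 fun _ _ ↦ Commute.one_right _
  have hε (g : Γ) (d : D) : ε (AddMonoidAlgebra.single g d) = d := by simp [ε]
  have hεφ (s) : ε (φ s) = ι s := by
    induction s using MixedCrossedAlgebra.mem_of_generators_mem with
    | hC c => rw [AlgHom.commutes, AlgHom.commutes, hA]; exact hε _ _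
    | hy i => rw [hφy, hε]; rfl
    | hx i => rw [hφx, hε]; rfl
    | hmul a b ha hb => rw [map_mul, map_mul, ha, hb, map_mul]
    | hadd a b ha hb => rw [map_add, map_add, ha, hb, map_add]
  refine ⟨HahnSeries.ofAddMonoidAlgebra.comp φ.toRingHom,
    HahnSeries.ofAddMonoidAlgebra_injective.comp fun a b h ↦ hι ?_, fun s ↦ ?_, hC⟩
  · rw [← hεφ, ← hεφ]
    exact congrArg ε h
  · change HahnSeries.ofAddMonoidAlgebra (φ s) ∈ _
    induction s using MixedCrossedAlgebra.mem_of_generators_mem with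
    | hC c =>
      rw [hC]
      exact X.single_mem_hahnSubring (X.algebraMap_mem_component c)
    | hy i =>
      rw [hφy, HahnSeries.ofAddMonoidAlgebra_single]
      exact X.single_mem_hahnSubring (hy i)
    | hx i =>
      rw [hφx, HahnSeries.ofAddMonoidAlgebra_single]
      exact X.single_mem_hahnSubring (hx i)
    | hmul a b ha hb =>
      rw [map_mul, map_mul]
      exact mul_mem ha hb
    | hadd a b ha hb =>
      rw [map_add, map_add]
      exact add_mem ha hb

/-- The extension of a grading by `Fin n → ℤ` to the same group with lexicographic order. -/
noncomputable def TranslationData.toLex {k D σ : Type*} [Field k] [DivisionRing D] [Algebra k D]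
    {n : ℕ} {L : Subgroup kˣ} {wt : (Fin n → ℤ) → σ → k}
    (X : TranslationData k D (Fin n → ℤ) σ L wt) :
    TranslationData k D (Lex (Fin n → ℤ)) σ L (fun g ↦ wt (ofLex g)) where
  poly := X.poly
  poly_injective := X.poly_injective
  m g := X.m (ofLex g)
  m_ne_zero _ := X.m_ne_zero _
  conj _ := X.conj _
  m_mul _ _ := X.m_mul _ _
  one_eq := X.one_eq

/-- For a division ring of fractions `D` of `S_{n,r}^Λ(k)`:
(1) the intersection of the derived subgroup of `D^×` with the nonzero scalars is the
subgroup generated by the entries of `Λ`; (2) the intersection of the `k`-span of the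
additive commutators with the scalars `k·1` is `k·1` if `r ≥ 1` and `{0}` if `r = 0`. -/
theorem stmt4 {k : Type u} [Field k] [CharZero k] {n : ℕ} (hn : 1 ≤ n) {r : ℕ} (hr : r ≤ n)
    (Λ : Matrix (Fin n) (Fin n) k) (hΛ : Λ.MulAntisymmetric)
    (F : FractionDivisionRing k (MixedCrossedAlgebra k Λ r hr)) :
    (∀ c : kˣ,
      (∃ u : (F.carrier)ˣ, u ∈ commutator (F.carrier)ˣ ∧
          (u : F.carrier) = algebraMap k F.carrier (c : k)) ↔
        c ∈ Subgroup.closure {x : kˣ | ∃ i j : Fin n, (x : k) = Λ i j}) ∧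
    (1 ≤ r → ∀ c : k, algebraMap k F.carrier c ∈
        Submodule.span k {d : F.carrier | ∃ a b : F.carrier, d = a * b - b * a}) ∧
    (r = 0 → ∀ c : k, algebraMap k F.carrier c ∈
        Submodule.span k {d : F.carrier | ∃ a b : F.carrier, d = a * b - b * a} → c = 0) := by
  have : IsOrderedAddMonoid (Lex (Fin n → ℤ)) := inferInstance
  let ι := F.emb
  have hS := MixedCrossedAlgebra.isMixedCrossedFamily (Λ := Λ) (hr := hr)
  have hy0 : ∀ i, ι (.y k Λ r hr i) ≠ 0 := fun i ↦
    (map_ne_zero_iff ι F.emb_injective).2 (MixedCrossedAlgebra.y_ne_zero hΛ i)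
  obtain ⟨X, hXy, hXx⟩ := (hS.map ι).exists_translationData hΛ hy0
  obtain ⟨φ, hφ, hmem, hC⟩ := exists_hahn_embedding X.toLex
    (fun i ↦ toLex (Pi.single i 1)) F.emb_injective hXy hXx
  refine ⟨fun c ↦ ⟨?_, fun hc ↦ ?_⟩, fun h1 c ↦ ?_, ?_⟩
  · rintro ⟨u, hu, huc⟩
    exact X.toLex.mem_of_mem_commutator MonomialOrder.lex F.emb_injective F.frac hφ hmem hC hu huc
  · refine ⟨Units.map (algebraMap k F.carrier : k →* F.carrier) c, ?_, rfl⟩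
    rw [← Subgroup.mem_comap]
    refine (Subgroup.closure_le _).2 ?_ hc
    rintro l ⟨i, j, hl⟩
    let Y (i : Fin n) : (F.carrier)ˣ := Units.mk0 (ι (.y k Λ r hr i)) (hy0 i)
    have : Units.map (algebraMap k F.carrier : k →* F.carrier) l =
        Y i * Y j * (Y i)⁻¹ * (Y j)⁻¹ := by
      rw [eq_mul_inv_iff_mul_eq, eq_mul_inv_iff_mul_eq]
      ext
      change algebraMap k F.carrier l * ι _ * ι _ = ι _ * ι _
      rw [← map_mul ι, hS.yy, hl, map_smul, map_mul, mul_assoc, ← Algebra.smul_def]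
    rw [SetLike.mem_coe, Subgroup.mem_comap, this]
    exact Subgroup.commutator_mem_commutator (Subgroup.mem_top _) (Subgroup.mem_top _)
  · let i : Fin r := ⟨0, h1⟩
    refine Submodule.subset_span ⟨c • ι (.x k Λ r hr i), ι (.y k Λ r hr (Fin.castLE hr i)), ?_⟩
    rw [smul_mul_assoc, mul_smul_comm, ← smul_sub, ← map_mul, ← map_mul, hS.xy_same, map_add,
      add_sub_cancel_left, map_one, Algebra.algebraMap_eq_smul_one]
  · rintro rfl c hc
    exact X.toLex.eq_zero_of_mem_span_commutators F.emb_injective F.frac hφ hmem hC hc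
end

section
/- Let n ≥ 1 and let Λ = (λ_{i,j}) ∈ M_n(k*) be multiplicatively antisymmetric. For the quantum torus O_Λ((k*)^n), the following conditions are equivalent: (1) O_Λ((k*)^n) is a simple ring (its only two-sided ideals are 0 and the whole ring); (2) the center of O_Λ((k*)^n) is reduced to the scalars k·1; (3) there is no α = (α_1,…,α_n) ∈ ℤ^n ∖ {0} such that λ_{1,j}^{α_1}·λ_{2,j}^{α_2}·…·λ_{n,j}^{α_n} = 1 for every 1 ≤ j ≤ n. -/
universe u

inductive QTorusRel (k : Type u) [Field k] {n : ℕ} (Λ : Matrix (Fin n) (Fin n) k) :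
    FreeAlgebra k (Fin n ⊕ Fin n) → FreeAlgebra k (Fin n ⊕ Fin n) → Prop
  | comm (i j : Fin n) :
      QTorusRel k Λ (FreeAlgebra.ι k (Sum.inl i) * FreeAlgebra.ι k (Sum.inl j))
        (algebraMap k _ (Λ i j) * (FreeAlgebra.ι k (Sum.inl j) * FreeAlgebra.ι k (Sum.inl i)))
  | mul_inv (i : Fin n) :
      QTorusRel k Λ (FreeAlgebra.ι k (Sum.inl i) * FreeAlgebra.ι k (Sum.inr i)) 1
  | inv_mul (i : Fin n) :
      QTorusRel k Λ (FreeAlgebra.ι k (Sum.inr i) * FreeAlgebra.ι k (Sum.inl i)) 1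

/-- The quantum torus `O_Λ((k*)^n)`. -/
def QuantumTorus (k : Type u) [Field k] {n : ℕ} (Λ : Matrix (Fin n) (Fin n) k) :=
  RingQuot (QTorusRel k Λ)

noncomputable instance (k : Type u) [Field k] {n : ℕ} (Λ : Matrix (Fin n) (Fin n) k) :
    Ring (QuantumTorus k Λ) := by unfold QuantumTorus; infer_instance

noncomputable instance (k : Type u) [Field k] {n : ℕ} (Λ : Matrix (Fin n) (Fin n) k) :
    Algebra k (QuantumTorus k Λ) := by unfold QuantumTorus; infer_instance

/-- The generator `y_i` of the quantum torus. -/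
noncomputable def QuantumTorus.y (k : Type u) [Field k] {n : ℕ}
    (Λ : Matrix (Fin n) (Fin n) k) (i : Fin n) : QuantumTorus k Λ :=
  RingQuot.mkAlgHom k (QTorusRel k Λ) (FreeAlgebra.ι k (Sum.inl i))

/-- The generator `y_i⁻¹` of the quantum torus. -/
noncomputable def QuantumTorus.yinv (k : Type u) [Field k] {n : ℕ}
    (Λ : Matrix (Fin n) (Fin n) k) (i : Fin n) : QuantumTorus k Λ :=
  RingQuot.mkAlgHom k (QTorusRel k Λ) (FreeAlgebra.ι k (Sum.inr i))


namespace QuantumTorus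

section Relations

variable {k : Type u} [Field k] {n : ℕ} (Λ : Matrix (Fin n) (Fin n) k)

/-- The projection from the free algebra onto the quantum torus. -/
noncomputable def proj : FreeAlgebra k (Fin n ⊕ Fin n) →ₐ[k] QuantumTorus k Λ :=
  RingQuot.mkAlgHom k (QTorusRel k Λ)

theorem proj_surjective : Function.Surjective (proj Λ) :=
  RingQuot.mkAlgHom_surjective k (QTorusRel k Λ)

theorem proj_rel {a b : FreeAlgebra k (Fin n ⊕ Fin n)} (h : QTorusRel k Λ a b) :
    proj Λ a = proj Λ b :=
  RingQuot.mkAlgHom_rel k h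

theorem proj_inl (i : Fin n) : proj Λ (FreeAlgebra.ι k (Sum.inl i)) = y k Λ i := rfl

theorem proj_inr (i : Fin n) : proj Λ (FreeAlgebra.ι k (Sum.inr i)) = yinv k Λ i := rfl

theorem y_mul_y (i j : Fin n) :
    y k Λ i * y k Λ j = algebraMap k _ (Λ i j) * (y k Λ j * y k Λ i) := by
  simpa only [map_mul, proj_inl, AlgHom.commutes] using proj_rel Λ (QTorusRel.comm i j)

theorem y_mul_yinv (i : Fin n) : y k Λ i * yinv k Λ i = 1 := by
  simpa only [map_mul, proj_inl, proj_inr, map_one] using proj_rel Λ (QTorusRel.mul_inv i)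

theorem yinv_mul_y (i : Fin n) : yinv k Λ i * y k Λ i = 1 := by
  simpa only [map_mul, proj_inl, proj_inr, map_one] using proj_rel Λ (QTorusRel.inv_mul i)

/-- The generator `y_i` as a unit. -/
noncomputable def yUnit (i : Fin n) : (QuantumTorus k Λ)ˣ :=
  ⟨y k Λ i, yinv k Λ i, y_mul_yinv Λ i, yinv_mul_y Λ i⟩

theorem val_yUnit (i : Fin n) : (yUnit Λ i : QuantumTorus k Λ) = y k Λ i := rfl

theorem val_yUnit_inv (i : Fin n) : ((yUnit Λ i)⁻¹ : (QuantumTorus k Λ)ˣ) = yinv k Λ i := rfl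

theorem eq_top_of_generators_mem {S : Subalgebra k (QuantumTorus k Λ)}
    (hy : ∀ i, y k Λ i ∈ S) (hyinv : ∀ i, yinv k Λ i ∈ S) : S = ⊤ := by
  have h : S.comap (proj Λ) = ⊤ := by
    rw [eq_top_iff, ← FreeAlgebra.adjoin_range_ι, Algebra.adjoin_le_iff]
    rintro _ ⟨i | i, rfl⟩
    · exact hy i
    · exact hyinv i
  refine Algebra.eq_top_iff.2 fun a => ?_
  obtain ⟨x, rfl⟩ := proj_surjective Λ a
  have hx : x ∈ S.comap (proj Λ) := h ▸ Algebra.mem_top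
  exact hx

/-- The algebra homomorphism out of the quantum torus given by units satisfying the
commutation relations. -/
noncomputable def lift {B : Type*} [Ring B] [Algebra k B] (f : Fin n → Bˣ)
    (hf : ∀ i j, (f i * f j : B) = algebraMap k B (Λ i j) * (f j * f i)) :
    QuantumTorus k Λ →ₐ[k] B :=
  RingQuot.liftAlgHom k (s := QTorusRel k Λ)
    ⟨FreeAlgebra.lift k (Sum.elim (fun i => (f i : B)) (fun i => ((f i)⁻¹ : Bˣ))), by
      intro a b h
      cases h with
      | comm i j => simp [hf i j]
      | mul_inv i => simp
      | inv_mul i => simp⟩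

theorem lift_y {B : Type*} [Ring B] [Algebra k B] (f : Fin n → Bˣ)
    (hf : ∀ i j, (f i * f j : B) = algebraMap k B (Λ i j) * (f j * f i)) (i : Fin n) :
    lift Λ f hf (y k Λ i) = f i := by
  unfold lift y
  exact (RingQuot.liftAlgHom_mkAlgHom_apply k _ _ _).trans (by simp)

end Relations

section Representation

variable {k : Type u} [Field k] {n : ℕ} (Λ : Matrix (Fin n) (Fin n) k)

/-- The scalar by which left multiplication by `y_i` twists the ordered monomial of
exponent `α`. -/
noncomputable def twist (i : Fin n) (α : Fin n → ℤ) : k :=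
  ∏ l : Fin n, if l < i then Λ i l ^ α l else 1

/-- The scalar by which the monomials of exponent `α` commute past `y_j`. -/
noncomputable def weight (α : Fin n → ℤ) (j : Fin n) : k := ∏ i : Fin n, Λ i j ^ α i

variable {Λ}

theorem entry_ne_zero (hΛ : Λ.MulAntisymmetric) (i j : Fin n) : Λ i j ≠ 0 :=
  left_ne_zero_of_mul_eq_one (hΛ.2 i j)

theorem twist_ne_zero (hΛ : Λ.MulAntisymmetric) (i : Fin n) (α : Fin n → ℤ) :
    twist Λ i α ≠ 0 :=
  Finset.prod_ne_zero_iff.2 fun l _ => by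
    split_ifs
    · exact zpow_ne_zero _ (entry_ne_zero hΛ i l)
    · exact one_ne_zero

theorem twist_single_add (hΛ : Λ.MulAntisymmetric) (i j : Fin n) (α : Fin n → ℤ) :
    twist Λ i (Pi.single j 1 + α) = (if j < i then Λ i j else 1) * twist Λ i α := by
  have h : (if j < i then Λ i j else 1) =
      ∏ l : Fin n, if l < i then Λ i l ^ (Pi.single j 1 : Fin n → ℤ) l else 1 := by
    rw [Finset.prod_eq_single j]
    · simp
    · intro l _ hl
      simp [Pi.single_eq_of_ne hl]
    · simp
  rw [h, twist, twist, ← Finset.prod_mul_distrib]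
  refine Finset.prod_congr rfl fun l _ => ?_
  split_ifs
  · rw [Pi.add_apply, zpow_add₀ (entry_ne_zero hΛ i l)]
  · simp

theorem weight_zero (j : Fin n) : weight Λ 0 j = 1 := by simp [weight]

theorem weight_add (hΛ : Λ.MulAntisymmetric) (α β : Fin n → ℤ) (j : Fin n) :
    weight Λ (α + β) j = weight Λ α j * weight Λ β j := by
  simp only [weight, ← Finset.prod_mul_distrib, Pi.add_apply,
    zpow_add₀ (entry_ne_zero hΛ _ _)]

theorem weight_neg_mul (hΛ : Λ.MulAntisymmetric) (α : Fin n → ℤ) (j : Fin n) :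
    weight Λ (-α) j * weight Λ α j = 1 := by
  rw [← weight_add hΛ, neg_add_cancel, weight_zero]

theorem weight_single (i j : Fin n) : weight Λ (Pi.single i 1) j = Λ i j := by
  rw [weight, Finset.prod_eq_single i]
  · simp
  · intro l _ hl
    simp [Pi.single_eq_of_ne hl]
  · simp

/-- The operator on `k[ℤⁿ]` by which `y_i` acts. -/
noncomputable def shift (hΛ : Λ.MulAntisymmetric) (i : Fin n) :
    (Module.End k ((Fin n → ℤ) →₀ k))ˣ where
  val := Finsupp.linearCombination k fun α =>
    Finsupp.single (Pi.single i 1 + α) (twist Λ i α)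
  inv := Finsupp.linearCombination k fun α =>
    Finsupp.single (-Pi.single i 1 + α) (twist Λ i (-Pi.single i 1 + α))⁻¹
  val_inv := by
    refine Finsupp.lhom_ext fun α c => ?_
    simp [Finsupp.linearCombination_single, twist_ne_zero hΛ, Finsupp.smul_single,
      -Finsupp.single_mul]
  inv_val := by
    refine Finsupp.lhom_ext fun α c => ?_
    simp [Finsupp.linearCombination_single, twist_ne_zero hΛ, Finsupp.smul_single,
      -Finsupp.single_mul]

theorem shift_single (hΛ : Λ.MulAntisymmetric) (i : Fin n) (α : Fin n → ℤ) (c : k) :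
    (shift hΛ i : Module.End k ((Fin n → ℤ) →₀ k)) (Finsupp.single α c) =
      Finsupp.single (Pi.single i 1 + α) (c * twist Λ i α) := by
  simp [shift, Finsupp.linearCombination_single]

/-- The regular representation of the quantum torus, in the basis of ordered monomials. -/
noncomputable def rep (hΛ : Λ.MulAntisymmetric) :
    QuantumTorus k Λ →ₐ[k] Module.End k ((Fin n → ℤ) →₀ k) :=
  lift Λ (B := Module.End k ((Fin n → ℤ) →₀ k)) (shift hΛ) fun i j => by
    refine Finsupp.lhom_ext fun α c => ?_
    simp only [Module.End.mul_apply, shift_single, Module.algebraMap_end_apply,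
      Finsupp.smul_single, twist_single_add hΛ, smul_eq_mul]
    rw [add_left_comm]
    congr 1
    rcases lt_trichotomy i j with h | rfl | h
    · rw [if_neg h.asymm, if_pos h]
      linear_combination -(c * twist Λ i α * twist Λ j α) * hΛ.2 i j
    · simp [hΛ.1]
    · rw [if_neg h.asymm, if_pos h]
      ring

end Representation

section Monomials

variable {k : Type u} [Field k] {n : ℕ} {Λ : Matrix (Fin n) (Fin n) k}

/-- A unit of the quantum torus which is homogeneous of multidegree `α`. -/
structure IsMonomial (hΛ : Λ.MulAntisymmetric) (α : Fin n → ℤ) (u : (QuantumTorus k Λ)ˣ) :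
    Prop where
  rep_single : ∀ β, ∃ c : k, c ≠ 0 ∧
    rep hΛ u (Finsupp.single β 1) = Finsupp.single (α + β) c
  mul_y : ∀ j, (u * y k Λ j : QuantumTorus k Λ) = weight Λ α j • (y k Λ j * u)

variable {hΛ : Λ.MulAntisymmetric}

theorem isMonomial_one : IsMonomial hΛ 0 1 where
  rep_single β := ⟨1, one_ne_zero, by simp⟩
  mul_y j := by simp [weight_zero]

theorem isMonomial_yUnit (i : Fin n) : IsMonomial hΛ (Pi.single i 1) (yUnit Λ i) where
  rep_single β := ⟨twist Λ i β, twist_ne_zero hΛ i β, by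
    rw [val_yUnit, rep, lift_y, shift_single, one_mul]⟩
  mul_y j := by rw [val_yUnit, y_mul_y, weight_single, Algebra.smul_def]

theorem IsMonomial.mul {α β : Fin n → ℤ} {u v : (QuantumTorus k Λ)ˣ}
    (hu : IsMonomial hΛ α u) (hv : IsMonomial hΛ β v) : IsMonomial hΛ (α + β) (u * v) where
  rep_single γ := by
    obtain ⟨c, hc, hcv⟩ := hv.rep_single γ
    obtain ⟨d, hd, hdu⟩ := hu.rep_single (β + γ)
    refine ⟨c * d, mul_ne_zero hc hd, ?_⟩
    have hs : (Finsupp.single (β + γ) c : (Fin n → ℤ) →₀ k) =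
      c • Finsupp.single (β + γ) 1 := by simp
    rw [Units.val_mul, map_mul, Module.End.mul_apply, hcv, hs, map_smul, hdu,
      Finsupp.smul_single, smul_eq_mul, add_assoc]
  mul_y j := by
    rw [Units.val_mul, mul_assoc, hv.mul_y, mul_smul_comm, ← mul_assoc, hu.mul_y,
      smul_mul_assoc, smul_smul, mul_assoc, weight_add hΛ, mul_comm (weight Λ α j)]

theorem IsMonomial.inv {α : Fin n → ℤ} {u : (QuantumTorus k Λ)ˣ}
    (hu : IsMonomial hΛ α u) : IsMonomial hΛ (-α) u⁻¹ where
  rep_single γ := by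
    obtain ⟨c, hc, hcu⟩ := hu.rep_single (-α + γ)
    refine ⟨c⁻¹, inv_ne_zero hc, ?_⟩
    rw [add_neg_cancel_left] at hcu
    have hs : (Finsupp.single γ 1 : (Fin n → ℤ) →₀ k) =
        c⁻¹ • rep hΛ u (Finsupp.single (-α + γ) 1) := by
      rw [hcu]; simp [hc]
    rw [hs, map_smul, ← Module.End.mul_apply, ← map_mul, Units.inv_mul]
    simp
  mul_y j := by
    have h := congrArg (fun x : QuantumTorus k Λ => (u⁻¹ : (QuantumTorus k Λ)ˣ) * x *
      (u⁻¹ : (QuantumTorus k Λ)ˣ)) (hu.mul_y j)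
    simp only [mul_smul_comm, smul_mul_assoc, Units.inv_mul_cancel_left, mul_assoc,
      Units.mul_inv, mul_one] at h
    rw [h, smul_smul, weight_neg_mul hΛ, one_smul]

variable (Λ) in
/-- The scalars, as units of the quantum torus. -/
noncomputable def scalarUnits : Subgroup (QuantumTorus k Λ)ˣ :=
  (Units.map (algebraMap k (QuantumTorus k Λ) : k →* QuantumTorus k Λ)).range

instance : (scalarUnits Λ).Normal where
  conj_mem := by
    rintro _ ⟨c, rfl⟩ g
    refine ⟨c, ?_⟩
    rw [eq_mul_inv_iff_mul_eq]
    ext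
    exact Algebra.commutes _ _

theorem exists_smul_of_mk_eq {u v : (QuantumTorus k Λ)ˣ}
    (h : (u : (QuantumTorus k Λ)ˣ ⧸ scalarUnits Λ) = v) :
    ∃ c : k, c ≠ 0 ∧ (u : QuantumTorus k Λ) = c • (v : QuantumTorus k Λ) := by
  obtain ⟨c, hc⟩ := QuotientGroup.eq.1 h.symm
  refine ⟨c, c.ne_zero, ?_⟩
  rw [eq_inv_mul_iff_mul_eq] at hc
  rw [← hc, Units.val_mul, Algebra.smul_def]
  exact (Algebra.commutes _ _).symm

theorem commute_mk_yUnit (hΛ : Λ.MulAntisymmetric) (i j : Fin n) :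
    Commute (yUnit Λ i : (QuantumTorus k Λ)ˣ ⧸ scalarUnits Λ) (yUnit Λ j) := by
  refine (QuotientGroup.eq (s := scalarUnits Λ)
    (a := yUnit Λ i * yUnit Λ j) (b := yUnit Λ j * yUnit Λ i)).2
    ⟨Units.mk0 (Λ j i) (entry_ne_zero hΛ j i), ?_⟩
  rw [eq_inv_mul_iff_mul_eq]
  ext
  simp only [Units.val_mul, Units.coe_map, MonoidHom.coe_coe, Units.val_mk0, val_yUnit]
  rw [y_mul_y Λ j i]
  exact (Algebra.commutes _ _).symm

theorem pairwise_commute_zpowers (hΛ : Λ.MulAntisymmetric) :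
    Pairwise fun i j => ∀ a b : Multiplicative ℤ,
      Commute (zpowersHom ((QuantumTorus k Λ)ˣ ⧸ scalarUnits Λ) ↑(yUnit Λ i) a)
        (zpowersHom ((QuantumTorus k Λ)ˣ ⧸ scalarUnits Λ) ↑(yUnit Λ j) b) := by
  intro i j _ a b
  simp only [zpowersHom_apply]
  exact (commute_mk_yUnit hΛ i j).zpow_zpow _ _

/-- The class modulo scalars of the monomials of a given exponent. -/
noncomputable def monomialClass (hΛ : Λ.MulAntisymmetric) :
    (Fin n → Multiplicative ℤ) →* (QuantumTorus k Λ)ˣ ⧸ scalarUnits Λ :=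
  MonoidHom.noncommPiCoprod (fun i => zpowersHom _ ↑(yUnit Λ i)) (pairwise_commute_zpowers hΛ)

theorem monomialClass_mulSingle (i : Fin n) (a : ℤ) :
    monomialClass hΛ (Pi.mulSingle i (Multiplicative.ofAdd a)) =
      (yUnit Λ i : (QuantumTorus k Λ)ˣ ⧸ scalarUnits Λ) ^ a := by
  rw [monomialClass, MonoidHom.noncommPiCoprod_mulSingle]
  simp [zpowersHom_apply]

variable (hΛ) in
/-- The exponents whose monomial class is represented by a homogeneous unit. -/
def representedExponents : Subgroup (Fin n → Multiplicative ℤ) where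
  carrier := {α | ∃ u : (QuantumTorus k Λ)ˣ, (u : (QuantumTorus k Λ)ˣ ⧸ scalarUnits Λ) =
    monomialClass hΛ α ∧ IsMonomial hΛ (fun i => (α i).toAdd) u}
  one_mem' := ⟨1, by simp, isMonomial_one⟩
  mul_mem' := by
    rintro α β ⟨u, hu, hu'⟩ ⟨v, hv, hv'⟩
    exact ⟨u * v, by simp [hu, hv], hu'.mul hv'⟩
  inv_mem' := by
    rintro α ⟨u, hu, hu'⟩
    exact ⟨u⁻¹, by simp [hu], hu'.inv⟩

theorem exists_isMonomial (hΛ : Λ.MulAntisymmetric) (α : Fin n → ℤ) :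
    ∃ u : (QuantumTorus k Λ)ˣ, (u : (QuantumTorus k Λ)ˣ ⧸ scalarUnits Λ) =
      monomialClass hΛ (fun i => Multiplicative.ofAdd (α i)) ∧ IsMonomial hΛ α u := by
  suffices h : (fun i => Multiplicative.ofAdd (α i)) ∈ representedExponents hΛ from h
  rw [← Finset.univ_prod_mulSingle fun i => Multiplicative.ofAdd (α i)]
  refine Subgroup.prod_mem _ fun i _ => ?_
  have hpow : (Pi.mulSingle i (Multiplicative.ofAdd (α i)) : Fin n → Multiplicative ℤ) =
      Pi.mulSingle i (Multiplicative.ofAdd 1) ^ α i := by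
    rw [← Pi.mulSingle_zpow, ← ofAdd_zsmul, smul_eq_mul, mul_one]
  rw [hpow]
  refine Subgroup.zpow_mem (representedExponents hΛ)
    ⟨yUnit Λ i, by rw [monomialClass_mulSingle, zpow_one], ?_⟩ _
  convert isMonomial_yUnit (hΛ := hΛ) i using 1
  ext l
  by_cases h : l = i
  · subst h; simp
  · simp [Pi.mulSingle_eq_of_ne h, Pi.single_eq_of_ne h]

theorem exists_monomial_basis (hΛ : Λ.MulAntisymmetric) :
    ∃ b : Module.Basis (Fin n → ℤ) k (QuantumTorus k Λ),
      (∀ α, IsUnit (b α)) ∧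
      (∀ α β, ∃ c : k, c ≠ 0 ∧ b α * b β = c • b (α + β)) ∧
      ∀ α j, b α * y k Λ j = weight Λ α j • (y k Λ j * b α) := by
  choose m hm hmon using exists_isMonomial hΛ
  have hli : LinearIndependent k fun α => (m α : QuantumTorus k Λ) := by
    choose c hc hcm using fun α => (hmon α).rep_single 0
    refine LinearIndependent.of_comp
      ((LinearMap.applyₗ (Finsupp.single 0 1)).comp (rep hΛ).toLinearMap) ?_
    have h := (Finsupp.basisSingleOne (R := k) (ι := Fin n → ℤ)).linearIndependent.units_smul
      fun α => Units.mk0 (c α) (hc α)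
    convert h using 1
    ext1 α
    simpa [Units.smul_def] using hcm α
  have hmul : ∀ α β, ∃ c : k, c ≠ 0 ∧
      (m α * m β : QuantumTorus k Λ) = c • (m (α + β) : QuantumTorus k Λ) := by
    intro α β
    refine exists_smul_of_mk_eq (u := m α * m β) ?_
    rw [QuotientGroup.mk_mul, hm, hm, hm, ← map_mul]
    rfl
  let V := Submodule.span k (Set.range fun α => (m α : QuantumTorus k Λ))
  have hV : ∀ (α : Fin n → ℤ) (u : (QuantumTorus k Λ)ˣ),
      (u : (QuantumTorus k Λ)ˣ ⧸ scalarUnits Λ) =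
        monomialClass hΛ (fun i => Multiplicative.ofAdd (α i)) →
      (u : QuantumTorus k Λ) ∈ V := by
    intro α u hu
    obtain ⟨c, -, hc⟩ := exists_smul_of_mk_eq (hu.trans (hm α).symm)
    rw [hc]
    exact V.smul_mem c (Submodule.subset_span ⟨α, rfl⟩)
  have hsingle : ∀ (i : Fin n) (a : ℤ),
      (fun l => Multiplicative.ofAdd ((Pi.single i a : Fin n → ℤ) l)) =
        Pi.mulSingle i (Multiplicative.ofAdd a) := by
    intro i a
    ext1 l
    by_cases h : l = i
    · subst h; simp
    · simp [Pi.mulSingle_eq_of_ne h, Pi.single_eq_of_ne h]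
  have hone : (1 : QuantumTorus k Λ) ∈ V := hV 0 1 (by
    rw [QuotientGroup.mk_one]; exact (map_one _).symm)
  have hVmul : ∀ a b, a ∈ V → b ∈ V → a * b ∈ V := by
    intro a b ha hb
    have hle : V * V ≤ V := by
      rw [Submodule.span_mul_span, Submodule.span_le]
      rintro _ ⟨_, ⟨α, rfl⟩, _, ⟨β, rfl⟩, rfl⟩
      obtain ⟨c, -, hc⟩ := hmul α β
      simp only [hc]
      exact V.smul_mem c (Submodule.subset_span ⟨_, rfl⟩)
    exact hle (Submodule.mul_mem_mul ha hb)
  have htop : V.toSubalgebra hone hVmul = ⊤ := by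
    refine eq_top_of_generators_mem Λ (fun i => ?_) fun i => ?_
    · refine hV (Pi.single i 1) (yUnit Λ i) ?_
      rw [hsingle, monomialClass_mulSingle, zpow_one]
    · refine hV (Pi.single i (-1)) (yUnit Λ i)⁻¹ ?_
      rw [hsingle, monomialClass_mulSingle, zpow_neg_one, QuotientGroup.mk_inv]
  have hspan : ⊤ ≤ V := fun a _ => by
    have ha : a ∈ V.toSubalgebra hone hVmul := htop ▸ Algebra.mem_top
    exact ha
  refine ⟨Module.Basis.mk hli hspan, ?_, ?_, ?_⟩
  · intro α
    rw [Module.Basis.mk_apply]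
    exact (m α).isUnit
  · intro α β
    simpa only [Module.Basis.mk_apply] using hmul α β
  · intro α j
    rw [Module.Basis.mk_apply]
    exact (hmon α).mul_y j

end Monomials

section Center

variable {k : Type u} [Field k] {n : ℕ} {Λ : Matrix (Fin n) (Fin n) k}

theorem mem_center_of_commute_y {a : QuantumTorus k Λ}
    (h : ∀ j, a * y k Λ j = y k Λ j * a) : a ∈ Subring.center (QuantumTorus k Λ) := by
  have htop : Subalgebra.centralizer k {a} = ⊤ := by
    refine eq_top_of_generators_mem Λ (fun i => ?_) fun i => ?_
    · rw [Subalgebra.mem_centralizer_iff]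
      rintro _ rfl
      exact h i
    · rw [Subalgebra.mem_centralizer_iff]
      rintro _ rfl
      exact (Commute.units_inv_right (u := yUnit Λ i) (h i)).eq
  rw [Subring.mem_center_iff]
  intro g
  have hg : g ∈ Subalgebra.centralizer k {a} := htop ▸ Algebra.mem_top
  exact ((Subalgebra.mem_centralizer_iff k).1 hg a rfl).symm

theorem algebraMap_mem_center (c : k) :
    algebraMap k (QuantumTorus k Λ) c ∈ Subring.center (QuantumTorus k Λ) :=
  Subring.mem_center_iff.2 fun g => (Algebra.commutes c g).symm

theorem weight_injective (hΛ : Λ.MulAntisymmetric)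
    (h : ¬ ∃ α : Fin n → ℤ, α ≠ 0 ∧ ∀ j : Fin n, ∏ i : Fin n, Λ i j ^ α i = 1) :
    Function.Injective (weight Λ) := by
  intro α β hαβ
  by_contra hne
  refine h ⟨-β + α, fun h0 => hne ?_, fun j => ?_⟩
  · exact (neg_add_eq_zero.1 h0).symm
  · have hw := weight_neg_mul hΛ β j
    rw [← hαβ, ← weight_add hΛ] at hw
    exact hw

variable {b : Module.Basis (Fin n → ℤ) k (QuantumTorus k Λ)}

theorem repr_conj_y (hy : ∀ α j, b α * y k Λ j = weight Λ α j • (y k Λ j * b α))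
    (a : QuantumTorus k Λ) (j : Fin n) (α : Fin n → ℤ) :
    b.repr (yinv k Λ j * (a * y k Λ j)) α = weight Λ α j * b.repr a α := by
  have hb : ∀ β, b.repr (yinv k Λ j * (b β * y k Λ j)) α = weight Λ α j * b.repr (b β) α := by
    intro β
    rw [hy, mul_smul_comm, ← mul_assoc, yinv_mul_y, one_mul, map_smul, Finsupp.smul_apply,
      smul_eq_mul, b.repr_self]
    by_cases hβ : β = α
    · rw [hβ]
    · simp [Finsupp.single_eq_of_ne' hβ]
  have h : b.coord α ∘ₗ Algebra.lmul k _ (yinv k Λ j) ∘ₗ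
      (Algebra.lmul k _).toLinearMap.flip (y k Λ j) = weight Λ α j • b.coord α :=
    b.ext hb
  exact LinearMap.congr_fun h a

theorem basis_zero_eq (hunit : ∀ α, IsUnit (b α))
    (hmul : ∀ α β, ∃ c : k, c ≠ 0 ∧ b α * b β = c • b (α + β)) :
    ∃ c : k, c ≠ 0 ∧ b 0 = algebraMap k _ c := by
  obtain ⟨c, hc, h⟩ := hmul 0 0
  refine ⟨c, hc, (hunit 0).mul_right_cancel ?_⟩
  rw [h, add_zero, Algebra.smul_def]

theorem center_eq_range (hunit : ∀ α, IsUnit (b α))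
    (hmul : ∀ α β, ∃ c : k, c ≠ 0 ∧ b α * b β = c • b (α + β))
    (hy : ∀ α j, b α * y k Λ j = weight Λ α j • (y k Λ j * b α))
    (hinj : Function.Injective (weight Λ)) :
    (Subring.center (QuantumTorus k Λ) : Set (QuantumTorus k Λ)) =
      Set.range (algebraMap k (QuantumTorus k Λ)) := by
  refine Set.Subset.antisymm (fun a ha => ?_) ?_
  · have hrepr : b.repr a = Finsupp.single 0 (b.repr a 0) := by
      ext α
      by_cases hα : α = 0
      · simp [hα]
      rw [Finsupp.single_eq_of_ne hα]
      obtain ⟨j, hj⟩ := Function.ne_iff.1 (hinj.ne hα)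
      rw [weight_zero] at hj
      have h := repr_conj_y hy a j α
      rw [← Subring.mem_center_iff.1 ha, ← mul_assoc, yinv_mul_y, one_mul] at h
      by_contra h0
      exact hj (mul_right_cancel₀ h0 (by rw [one_mul]; exact h.symm))
    obtain ⟨c, -, hc⟩ := basis_zero_eq hunit hmul
    refine ⟨b.repr a 0 * c, ?_⟩
    apply b.repr.injective
    rw [map_mul, ← hc, ← Algebra.smul_def, map_smul, b.repr_self, hrepr]
    simp
  · rintro _ ⟨c, rfl⟩
    exact algebraMap_mem_center c

theorem eq_top_of_mem_ideal (hunit : ∀ α, IsUnit (b α))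
    (hy : ∀ α j, b α * y k Λ j = weight Λ α j • (y k Λ j * b α))
    (hinj : Function.Injective (weight Λ)) (I : TwoSidedIdeal (QuantumTorus k Λ))
    (N : ℕ) (a : QuantumTorus k Λ) (ha : a ∈ I) (ha0 : a ≠ 0)
    (hN : (b.repr a).support.card = N) : I = ⊤ := by
  induction N using Nat.strong_induction_on generalizing a with
  | _ N ih =>
    obtain ⟨α, hα⟩ := Finsupp.support_nonempty_iff.2 (b.repr.map_ne_zero_iff.2 ha0)
    have hsmul : ∀ (c : k) {x}, x ∈ I → c • x ∈ I := fun c x hx => by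
      rw [Algebra.smul_def]
      exact I.mul_mem_left _ _ hx
    by_cases hsupp : ∃ β ∈ (b.repr a).support, β ≠ α
    · obtain ⟨β, hβ, hne⟩ := hsupp
      obtain ⟨j, hj⟩ := Function.ne_iff.1 (hinj.ne hne)
      set a' := yinv k Λ j * (a * y k Λ j) - weight Λ α j • a with ha'
      have hrepr : ∀ γ, b.repr a' γ = (weight Λ γ j - weight Λ α j) * b.repr a γ := by
        intro γ
        rw [ha', map_sub, Finsupp.sub_apply, repr_conj_y hy, map_smul, Finsupp.smul_apply,
          smul_eq_mul, sub_mul]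
      refine ih _ ?_ a' ?_ ?_ rfl
      · rw [← hN]
        refine Finset.card_lt_card ((Finset.ssubset_iff_of_subset fun γ hγ => ?_).2
          ⟨α, hα, ?_⟩)
        · rw [Finsupp.mem_support_iff, hrepr] at hγ
          exact Finsupp.mem_support_iff.2 (right_ne_zero_of_mul hγ)
        · simp [hrepr]
      · exact I.sub_mem (I.mul_mem_left _ _ (I.mul_mem_right _ _ ha)) (hsmul _ ha)
      · intro h0
        have h := hrepr β
        rw [h0, map_zero, Finsupp.zero_apply] at h
        exact mul_ne_zero (sub_ne_zero.2 hj) (Finsupp.mem_support_iff.1 hβ) h.symm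
    · push Not at hsupp
      have hrepr : b.repr a = Finsupp.single α (b.repr a α) := by
        refine Finsupp.support_subset_singleton.1 fun β hβ => ?_
        exact Finset.mem_singleton.2 (hsupp β hβ)
      have hab : a = b.repr a α • b α := by
        apply b.repr.injective
        rw [map_smul, b.repr_self, Finsupp.smul_single, smul_eq_mul, mul_one, ← hrepr]
      have hb : b α ∈ I := by
        have h := hsmul (b.repr a α)⁻¹ ha
        rw [hab] at h
        simpa [smul_smul, Finsupp.mem_support_iff.1 hα] using h
      obtain ⟨v, hv⟩ := (hunit α).exists_left_inv
      rw [← TwoSidedIdeal.one_mem_iff, ← hv]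
      exact I.mul_mem_left _ _ hb

theorem isSimpleRing (hunit : ∀ α, IsUnit (b α))
    (hy : ∀ α j, b α * y k Λ j = weight Λ α j • (y k Λ j * b α))
    (hinj : Function.Injective (weight Λ)) : IsSimpleRing (QuantumTorus k Λ) := by
  have : Nontrivial (QuantumTorus k Λ) := ⟨b 0, 0, b.ne_zero 0⟩
  refine ⟨⟨fun I => ?_⟩⟩
  by_cases h : I = ⊥
  · exact Or.inl h
  right
  obtain ⟨a, ha, ha0⟩ : ∃ a ∈ I, a ≠ 0 := by
    by_contra! hI
    exact h (le_bot_iff.1 fun a ha => (TwoSidedIdeal.mem_bot _).2 (hI a ha))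
  exact eq_top_of_mem_ideal hunit hy hinj I _ a ha ha0 rfl

theorem basis_mem_center (hy : ∀ α j, b α * y k Λ j = weight Λ α j • (y k Λ j * b α))
    {α : Fin n → ℤ} (hα : ∀ j, weight Λ α j = 1) :
    b α ∈ Subring.center (QuantumTorus k Λ) :=
  mem_center_of_commute_y fun j => by rw [hy, hα, one_smul]

theorem basis_notMem_range (hunit : ∀ α, IsUnit (b α))
    (hmul : ∀ α β, ∃ c : k, c ≠ 0 ∧ b α * b β = c • b (α + β))
    {α : Fin n → ℤ} (hα : α ≠ 0) :
    b α ∉ Set.range (algebraMap k (QuantumTorus k Λ)) := by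
  rintro ⟨d, hd⟩
  obtain ⟨c, hc, h0⟩ := basis_zero_eq hunit hmul
  have h : b.repr (c • b α) = b.repr (d • b 0) := by
    rw [Algebra.smul_def, Algebra.smul_def, ← hd, h0, ← map_mul, ← map_mul, mul_comm]
  have hv := DFunLike.congr_fun h α
  simp [Finsupp.single_eq_of_ne hα, hc] at hv

theorem repr_basis_mul (hmul : ∀ α β, ∃ c : k, c ≠ 0 ∧ b α * b β = c • b (α + β))
    (α β : Fin n → ℤ) :
    ∃ c : k, c ≠ 0 ∧ ∀ a, b.repr (b α * a) (α + β) = c * b.repr a β := by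
  obtain ⟨c, hc, h⟩ := hmul α β
  refine ⟨c, hc, fun a => ?_⟩
  have hb : ∀ γ, b.repr (b α * b γ) (α + β) = c * b.repr (b γ) β := by
    intro γ
    by_cases hγ : γ = β
    · simp [hγ, h]
    · obtain ⟨d, -, hd⟩ := hmul α γ
      have hγ' : α + γ ≠ α + β := fun h' => hγ (add_left_cancel h')
      simp [hd, Finsupp.single_eq_of_ne' hγ, Finsupp.single_eq_of_ne' hγ']
  have hL : b.coord (α + β) ∘ₗ Algebra.lmul k _ (b α) = c • b.coord β := b.ext hb
  exact LinearMap.congr_fun hL a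

/-- Adding `1` to a nonscalar monomial does not give a unit: an inverse would have infinite
support. -/
theorem one_add_basis_mul_ne_one (hunit : ∀ α, IsUnit (b α))
    (hmul : ∀ α β, ∃ c : k, c ≠ 0 ∧ b α * b β = c • b (α + β))
    {α : Fin n → ℤ} (hα : α ≠ 0) (a : QuantumTorus k Λ) : (1 + b α) * a ≠ 1 := by
  intro ha
  obtain ⟨d, hd, h0⟩ := basis_zero_eq hunit hmul
  have hone : b.repr 1 = Finsupp.single 0 d⁻¹ := by
    have h1 : (1 : QuantumTorus k Λ) = d⁻¹ • b 0 := by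
      rw [h0, Algebra.smul_def, ← map_mul, inv_mul_cancel₀ hd, map_one]
    rw [h1]; simp
  have hzinj : Function.Injective fun t : ℤ => t • α := smul_left_injective ℤ hα
  have hstep : ∀ t : ℤ, ∃ c : k, c ≠ 0 ∧
      b.repr a ((t + 1) • α) + c * b.repr a (t • α) = b.repr 1 ((t + 1) • α) := by
    intro t
    obtain ⟨c, hc, h⟩ := repr_basis_mul hmul α (t • α)
    refine ⟨c, hc, ?_⟩
    rw [← h, ← ha, add_mul, one_mul, b.repr.map_add, Finsupp.add_apply, add_smul, one_smul,
      add_comm (t • α)]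
  have hnext : ∀ t : ℤ, t + 1 ≠ 0 → b.repr a (t • α) ≠ 0 → b.repr a ((t + 1) • α) ≠ 0 := by
    intro t ht hne hz
    obtain ⟨c, hc, h⟩ := hstep t
    rw [hone, Finsupp.single_eq_of_ne (smul_ne_zero ht hα), hz, zero_add] at h
    exact mul_ne_zero hc hne h
  have hprev : ∀ t : ℤ, t + 1 ≠ 0 → b.repr a ((t + 1) • α) ≠ 0 → b.repr a (t • α) ≠ 0 := by
    intro t ht hne hz
    obtain ⟨c, hc, h⟩ := hstep t
    rw [hone, Finsupp.single_eq_of_ne (smul_ne_zero ht hα), hz, mul_zero, add_zero] at h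
    exact hne h
  have hfin : ∀ f : ℕ → ℤ, Function.Injective f → ¬ ∀ s, b.repr a (f s • α) ≠ 0 := by
    intro f hf h
    exact Set.infinite_of_injective_forall_mem (hzinj.comp hf)
      (s := ((b.repr a).support : Set (Fin n → ℤ)))
      (fun s => Finsupp.mem_support_iff.2 (h s)) (Finset.finite_toSet _)
  by_cases hneg : b.repr a ((-1 : ℤ) • α) = 0
  · refine hfin (fun s => s) Nat.cast_injective fun s => ?_
    induction s with
    | zero =>
      intro hz
      obtain ⟨c, hc, h⟩ := hstep (-1)
      rw [hneg, neg_add_cancel, hone] at h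
      rw [Nat.cast_zero] at hz
      rw [hz] at h
      simp [hd.symm] at h
    | succ s ih =>
      push_cast
      exact hnext s (by lia) ih
  · refine hfin (fun s => -1 - s) (fun s t h => by simpa using h) fun s => ?_
    induction s with
    | zero => simpa using hneg
    | succ s ih =>
      refine hprev _ (by push_cast; lia) ?_
      push_cast at ih ⊢
      rwa [show (-1 - ((s : ℤ) + 1) + 1) = -1 - s by ring]

theorem not_isSimpleRing (hunit : ∀ α, IsUnit (b α))
    (hmul : ∀ α β, ∃ c : k, c ≠ 0 ∧ b α * b β = c • b (α + β))
    (hy : ∀ α j, b α * y k Λ j = weight Λ α j • (y k Λ j * b α))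
    {α : Fin n → ℤ} (hα : α ≠ 0) (hw : ∀ j, weight Λ α j = 1) :
    ¬ IsSimpleRing (QuantumTorus k Λ) := by
  intro hs
  let z : Subring.center (QuantumTorus k Λ) := 1 + ⟨b α, basis_mem_center hy hw⟩
  have hz : z ≠ 0 := by
    intro h
    refine basis_notMem_range hunit hmul hα ⟨-1, ?_⟩
    have h' : (1 : QuantumTorus k Λ) + b α = 0 := congrArg Subtype.val h
    rw [map_neg, map_one]
    exact (eq_neg_of_add_eq_zero_right h').symm
  obtain ⟨w, hzw⟩ := (IsSimpleRing.isField_center (QuantumTorus k Λ)).mul_inv_cancel hz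
  exact one_add_basis_mul_ne_one hunit hmul hα w (congrArg Subtype.val hzw)

end Center

end QuantumTorus

/-- For a quantum torus `O_Λ((k*)^n)` the following are equivalent:
(1) it is a simple ring; (2) its center reduces to the scalars `k·1`;
(3) there is no `α ∈ ℤ^n ∖ {0}` with `∏_i λ_{i,j}^{α_i} = 1` for all `j`. -/
theorem stmt5 {k : Type u} [Field k] [CharZero k] {n : ℕ} (hn : 1 ≤ n)
    (Λ : Matrix (Fin n) (Fin n) k) (hΛ : Λ.MulAntisymmetric) :
    (IsSimpleRing (QuantumTorus k Λ) ↔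
      (Subring.center (QuantumTorus k Λ) : Set (QuantumTorus k Λ)) =
        Set.range (algebraMap k (QuantumTorus k Λ))) ∧
    ((Subring.center (QuantumTorus k Λ) : Set (QuantumTorus k Λ)) =
        Set.range (algebraMap k (QuantumTorus k Λ)) ↔
      ¬ ∃ α : Fin n → ℤ, α ≠ 0 ∧ ∀ j : Fin n, ∏ i : Fin n, Λ i j ^ α i = 1) := by
  obtain ⟨b, hunit, hmul, hy⟩ := QuantumTorus.exists_monomial_basis hΛ
  have h31 : (¬ ∃ α : Fin n → ℤ, α ≠ 0 ∧ ∀ j : Fin n, ∏ i : Fin n, Λ i j ^ α i = 1) →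
      IsSimpleRing (QuantumTorus k Λ) := fun h =>
    QuantumTorus.isSimpleRing hunit hy (QuantumTorus.weight_injective hΛ h)
  have h13 : IsSimpleRing (QuantumTorus k Λ) →
      ¬ ∃ α : Fin n → ℤ, α ≠ 0 ∧ ∀ j : Fin n, ∏ i : Fin n, Λ i j ^ α i = 1 := by
    rintro hs ⟨α, hα, hw⟩
    exact QuantumTorus.not_isSimpleRing hunit hmul hy hα hw hs
  have h23 : (Subring.center (QuantumTorus k Λ) : Set (QuantumTorus k Λ)) =
        Set.range (algebraMap k (QuantumTorus k Λ)) ↔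
      ¬ ∃ α : Fin n → ℤ, α ≠ 0 ∧ ∀ j : Fin n, ∏ i : Fin n, Λ i j ^ α i = 1 := by
    constructor
    · rintro hc ⟨α, hα, hw⟩
      exact QuantumTorus.basis_notMem_range hunit hmul hα
        (hc ▸ QuantumTorus.basis_mem_center hy hw)
    · exact fun h =>
        QuantumTorus.center_eq_range hunit hmul hy (QuantumTorus.weight_injective hΛ h)
  exact ⟨⟨fun h => h23.2 (h13 h), fun h => h31 (h23.1 h)⟩, h23⟩
end
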